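/- arXiv:1806.05222 — 5 statements merged into one kernel-verified Lean document; each statement's English description precedes it below -/
import Mathlib

section
/- Let K be a field of characteristic zero with algebraic closure Kbar, and let q_1, ..., q_t in K[x] be monic nonconstant pairwise coprime squarefree polynomials with q_i(0) != 0 for all i. Let V be the t-by-t matrix over Kbar with (i,j) entry V_{i,j} = sum over the distinct roots r of q_i in Kbar of r^j, for 1 <= i, j <= t. Assume V is invertible. If p = prod_{i=1}^t q_i^{m_i} and p' = prod_{i=1}^t q_i^{m_i'} with integers m_i >= 1 and m_i' >= 1, and the codegree-j coefficients of p and p' are equal for every 1 <= j <= t, then m_i = m_i' for every i. (Sufficiency direction of Theorem 4.) -/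
open Polynomial Finset Matrix

/-- The Newton identities for the elementary symmetric functions and power sums of a multiset. -/
theorem Multiset.sum_map_pow_eq_mul_esymm_sub_sum {R : Type*} [CommRing R] (s : Multiset R)
    {k : ℕ} (hk : 0 < k) :
    (s.map (· ^ k)).sum = (-1) ^ (k + 1) * k * s.esymm k -
      ∑ a ∈ HasAntidiagonal.antidiagonal k with a.1 ∈ Set.Ioo 0 k,
        (-1) ^ a.1 * s.esymm a.1 * (s.map (· ^ a.2)).sum := by
  classical
  have hpsum (n : ℕ) : MvPolynomial.aeval (fun x : s ↦ (x : R)) (MvPolynomial.psum s R n) =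
      (s.map (· ^ n)).sum := by
    rw [← s.map_univ fun x ↦ x ^ n]
    simp [MvPolynomial.psum]
  have h := congrArg (MvPolynomial.aeval fun x : s ↦ (x : R))
    (MvPolynomial.psum_eq_mul_esymm_sub_sum s R k hk)
  simpa only [map_sub, map_mul, map_pow, map_neg, map_one, map_natCast, map_sum, hpsum,
    MvPolynomial.aeval_esymm_eq_multiset_esymm, Multiset.map_univ_coe] using h

theorem Multiset.sum_map_pow_eq_of_esymm_eq {R : Type*} [CommRing R] {s s' : Multiset R} {n : ℕ}
    (h : ∀ j, 1 ≤ j → j ≤ n → s.esymm j = s'.esymm j) {k : ℕ} (hk : 1 ≤ k) (hkn : k ≤ n) :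
    (s.map (· ^ k)).sum = (s'.map (· ^ k)).sum := by
  induction k using Nat.strong_induction_on with
  | _ k ih =>
    rw [s.sum_map_pow_eq_mul_esymm_sub_sum hk, s'.sum_map_pow_eq_mul_esymm_sub_sum hk,
      h k hk hkn]
    congr 1
    refine Finset.sum_congr rfl fun a ha ↦ ?_
    simp only [Finset.mem_filter, HasAntidiagonal.mem_antidiagonal, Set.mem_Ioo] at ha
    rw [h a.1 (by lia) (by lia), ih a.2 (by lia) (by lia) (by lia)]

theorem Polynomial.Monic.esymm_roots_map {K L : Type*} [Field K] [Field L] [IsAlgClosed L]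
    (f : K →+* L) {p : K[X]} (hp : p.Monic) {j : ℕ} (hj : j ≤ p.natDegree) :
    (p.map f).roots.esymm j = (-1) ^ j * f (p.coeff (p.natDegree - j)) := by
  have hcard : (p.map f).roots.card = (p.map f).natDegree :=
    splits_iff_card_roots.mp (IsAlgClosed.splits _)
  have h := coeff_eq_esymm_roots_of_card hcard (k := p.natDegree - j) (by simp)
  rw [coeff_map, (hp.map f).leadingCoeff, hp.natDegree_map, Nat.sub_sub_self hj, one_mul] at h
  rw [h, ← mul_assoc, ← mul_pow]
  simp

theorem Polynomial.sum_map_roots_prod_pow {ι K M : Type*} [Field K] [AddCommMonoid M]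
    (s : Finset ι) {q : ι → K[X]} (hq : ∀ i ∈ s, q i ≠ 0) (m : ι → ℕ) (g : K → M) :
    ((∏ i ∈ s, q i ^ m i).roots.map g).sum = ∑ i ∈ s, m i • ((q i).roots.map g).sum := by
  rw [roots_prod _ _ (Finset.prod_ne_zero_iff.mpr fun i hi ↦ pow_ne_zero _ (hq i hi)),
    Multiset.map_bind, Multiset.sum_bind]
  simp only [roots_pow, Multiset.map_nsmul, Multiset.sum_nsmul]
  rfl

theorem Polynomial.card_le_natDegree_prod_pow {ι K : Type*} [Field K] (s : Finset ι)
    {q : ι → K[X]} (hq : ∀ i ∈ s, 0 < (q i).natDegree) {m : ι → ℕ} (hm : ∀ i ∈ s, 1 ≤ m i) :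
    s.card ≤ (∏ i ∈ s, q i ^ m i).natDegree := by
  rw [natDegree_prod _ _ fun i hi ↦ pow_ne_zero _ (ne_zero_of_natDegree_gt (hq i hi)),
    Finset.card_eq_sum_ones]
  refine Finset.sum_le_sum fun i hi ↦ ?_
  rw [natDegree_pow]
  exact Nat.mul_pos (hm i hi) (hq i hi)

/-- Sufficiency direction of Theorem 4: if the power-sum matrix `V` of the distinct
roots of the pairwise coprime squarefree factors `q_i` is invertible, then the
multiplicities `m_i` in `p = ∏ q_i^{m_i}` are determined by the first `t` proper
leading coefficients. -/
theorem multiplicities_determined_of_powerSum_matrix_invertible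
    {K : Type*} [Field K] [CharZero K] [DecidableEq (AlgebraicClosure K)] {t : ℕ}
    (q : Fin t → K[X]) (hmonic : ∀ i, (q i).Monic)
    (hdeg : ∀ i, 0 < (q i).natDegree)
    (hcop : Pairwise fun i j => IsCoprime (q i) (q j))
    (hsq : ∀ i, Squarefree (q i))
    (h0 : ∀ i, (q i).coeff 0 ≠ 0)
    (V : Matrix (Fin t) (Fin t) (AlgebraicClosure K))
    (hV : ∀ i j : Fin t, V i j =
      ∑ r ∈ ((q i).map (algebraMap K (AlgebraicClosure K))).roots.toFinset,
        r ^ ((j : ℕ) + 1))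
    (hVunit : IsUnit V)
    (m m' : Fin t → ℕ) (hm : ∀ i, 1 ≤ m i) (hm' : ∀ i, 1 ≤ m' i)
    (p p' : K[X]) (hp : p = ∏ i, q i ^ m i) (hp' : p' = ∏ i, q i ^ m' i)
    (hcoeff : ∀ j, 1 ≤ j → j ≤ t →
      p.coeff (p.natDegree - j) = p'.coeff (p'.natDegree - j)) :
    ∀ i, m i = m' i := by
  have hpsum (n : Fin t → ℕ) (j : Fin t) :
      (((∏ i, q i ^ n i).map (algebraMap K (AlgebraicClosure K))).roots.map
        (· ^ ((j : ℕ) + 1))).sum = ((fun i ↦ (n i : AlgebraicClosure K)) ᵥ* V) j := by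
    simp only [Polynomial.map_prod, Polynomial.map_pow]
    rw [sum_map_roots_prod_pow _ fun i _ ↦ ((hmonic i).map _).ne_zero]
    simp only [Matrix.vecMul, dotProduct, nsmul_eq_mul]
    refine Finset.sum_congr rfl fun i _ ↦ ?_
    have hnodup : ((q i).map (algebraMap K (AlgebraicClosure K))).roots.Nodup :=
      nodup_roots (PerfectField.separable_iff_squarefree.mpr (hsq i)).map
    rw [hV, Finset.sum, Multiset.toFinset_val, hnodup.dedup]
  have hmon (n : Fin t → ℕ) : (∏ i, q i ^ n i).Monic :=
    monic_prod_of_monic _ _ fun i _ ↦ (hmonic i).pow _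
  have hle (n : Fin t → ℕ) (hn : ∀ i, 1 ≤ n i) : t ≤ (∏ i, q i ^ n i).natDegree := by
    simpa using card_le_natDegree_prod_pow univ (fun i _ ↦ hdeg i) fun i _ ↦ hn i
  subst hp hp'
  have hvec : (fun i ↦ (m i : AlgebraicClosure K)) = fun i ↦ (m' i : AlgebraicClosure K) := by
    refine vecMul_injective_of_isUnit hVunit (funext fun j ↦ ?_)
    beta_reduce
    rw [← hpsum, ← hpsum]
    refine Multiset.sum_map_pow_eq_of_esymm_eq (n := t) (fun k hk hkt ↦ ?_) (by lia) (by lia)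
    rw [(hmon m).esymm_roots_map _ (hkt.trans (hle m hm)),
      (hmon m').esymm_roots_map _ (hkt.trans (hle m' hm')), hcoeff k hk hkt]
  exact fun i ↦ Nat.cast_injective (congrFun hvec i)
end

section
/- Let n >= 2 and let r_1, ..., r_n be pairwise distinct complex numbers. Set m = min(min_{i != j} |r_i - r_j|, 1). Let rtilde_1, ..., rtilde_n be complex numbers with |rtilde_i - r_i| <= epsilon for all i, where 0 < epsilon < m/4 (so the rtilde_i are also pairwise distinct). Then for every index i, | prod_{k != i} (rtilde_i - rtilde_k)^{-1} - prod_{k != i} (r_i - r_k)^{-1} | <= 2^{2n+2} * epsilon / m^{n+2}. (Perturbation bound for the diagonal factor Delta in the Soto-Eguibar--Moya-Cessa decomposition of the inverse Vandermonde matrix, from the proof of Theorem 3.) -/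
open Finset

/-- If two families in a normed field are bounded by `B ≥ 1` and are termwise `δ`-close, their
products over `s` differ by at most `#s * B ^ #s * δ`. -/
lemma norm_prod_sub_prod_le_card_mul {ι 𝕜 : Type*} [NormedField 𝕜] (s : Finset ι)
    (f g : ι → 𝕜) {B δ : ℝ} (hB : 1 ≤ B) (hf : ∀ k ∈ s, ‖f k‖ ≤ B) (hg : ∀ k ∈ s, ‖g k‖ ≤ B)
    (hfg : ∀ k ∈ s, ‖f k - g k‖ ≤ δ) :
    ‖∏ k ∈ s, f k - ∏ k ∈ s, g k‖ ≤ s.card * B ^ s.card * δ := by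
  classical
  induction s using Finset.induction_on with
  | empty => simp
  | insert a s ha ih =>
    simp only [Finset.forall_mem_insert] at hf hg hfg
    have ih := ih hf.2 hg.2 hfg.2
    have hq : ‖∏ k ∈ s, g k‖ ≤ B ^ s.card := by
      rw [norm_prod, ← Finset.prod_const]
      exact Finset.prod_le_prod (fun _ _ => norm_nonneg _) hg.2
    have hδ : 0 ≤ δ := (norm_nonneg _).trans hfg.1
    have hBs : 0 ≤ B ^ s.card := by positivity
    rw [Finset.prod_insert ha, Finset.prod_insert ha, Finset.card_insert_of_notMem ha]
    push_cast
    calc ‖f a * ∏ k ∈ s, f k - g a * ∏ k ∈ s, g k‖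
        = ‖f a * (∏ k ∈ s, f k - ∏ k ∈ s, g k) + (f a - g a) * ∏ k ∈ s, g k‖ := by
          congr 1; ring
      _ ≤ ‖f a‖ * ‖∏ k ∈ s, f k - ∏ k ∈ s, g k‖ + ‖f a - g a‖ * ‖∏ k ∈ s, g k‖ := by
          simpa only [norm_mul] using norm_add_le (f a * (∏ k ∈ s, f k - ∏ k ∈ s, g k))
            ((f a - g a) * ∏ k ∈ s, g k)
      _ ≤ B * (s.card * B ^ s.card * δ) + δ * B ^ s.card := by
          gcongr
          exacts [hf.1, hfg.1]
      _ ≤ (s.card + 1) * B ^ (s.card + 1) * δ := by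
          have := mul_nonneg (mul_nonneg hδ hBs) (sub_nonneg.2 hB)
          rw [pow_succ]
          linarith

/-- Perturbation bound for the diagonal factor `Δ` of the Soto-Eguibar–Moya-Cessa
decomposition of the inverse Vandermonde matrix (from the proof of Theorem 3). -/
theorem delta_perturbation_bound (n : ℕ) (hn : 2 ≤ n)
    (r : Fin n → ℂ) (hr : Function.Injective r)
    (m : ℝ)
    (hm : m = min (sInf {d : ℝ | ∃ i j : Fin n, i ≠ j ∧ d = ‖r i - r j‖}) 1)
    (rt : Fin n → ℂ) (ε : ℝ) (hε0 : 0 < ε) (hεm : ε < m / 4)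
    (hrt : ∀ i, ‖rt i - r i‖ ≤ ε) :
    ∀ i : Fin n,
      ‖(∏ k ∈ Finset.univ.erase i, (rt i - rt k)⁻¹) -
          ∏ k ∈ Finset.univ.erase i, (r i - r k)⁻¹‖ ≤
        2 ^ (2 * n + 2) * ε / m ^ (n + 2) := by
  intro i
  have hm0 : 0 < m := by linarith
  have hm1 : m ≤ 1 := hm ▸ min_le_right _ _
  have hsep : ∀ k, k ≠ i → m ≤ ‖r i - r k‖ := fun k hk => by
    rw [hm]
    refine (min_le_left _ _).trans (csInf_le ⟨0, ?_⟩ ⟨i, k, hk.symm, rfl⟩)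
    rintro _ ⟨_, _, -, rfl⟩
    exact norm_nonneg _
  have hdiff : ∀ k, ‖(r i - r k) - (rt i - rt k)‖ ≤ 2 * ε := fun k => by
    calc ‖(r i - r k) - (rt i - rt k)‖ = ‖(rt k - r k) - (rt i - r i)‖ := by congr 1; ring
      _ ≤ ‖rt k - r k‖ + ‖rt i - r i‖ := norm_sub_le _ _
      _ ≤ 2 * ε := by linarith [hrt k, hrt i]
  have hsep' : ∀ k, k ≠ i → m / 2 ≤ ‖rt i - rt k‖ := fun k hk => by
    linarith [hsep k hk, hdiff k, norm_sub_norm_le (r i - r k) (rt i - rt k)]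
  have hinv : ∀ z : ℂ, m / 2 ≤ ‖z‖ → ‖z⁻¹‖ ≤ 2 / m := fun z hz => by
    rw [norm_inv, ← inv_div m 2]
    exact inv_anti₀ (by positivity) hz
  have hB : 1 ≤ 2 / m := by rw [le_div_iff₀ hm0]; linarith
  have key := norm_prod_sub_prod_le_card_mul (Finset.univ.erase i)
    (fun k => (rt i - rt k)⁻¹) (fun k => (r i - r k)⁻¹) (δ := 2 * ε / (m / 2 * m)) hB
    (fun k hk => hinv _ (hsep' k (Finset.ne_of_mem_erase hk)))
    (fun k hk => hinv _ (by linarith [hsep k (Finset.ne_of_mem_erase hk)]))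
    (fun k hk => by
      have h1 := hsep k (Finset.ne_of_mem_erase hk)
      have h2 := hsep' k (Finset.ne_of_mem_erase hk)
      have h3 : r i - r k ≠ 0 := norm_pos_iff.1 (by linarith)
      have h4 : rt i - rt k ≠ 0 := norm_pos_iff.1 (by linarith)
      rw [inv_sub_inv h4 h3, norm_div, norm_mul]
      gcongr
      exact hdiff k)
  rw [Finset.card_erase_of_mem (Finset.mem_univ i), Finset.card_univ, Fintype.card_fin] at key
  refine key.trans ?_
  obtain ⟨p, rfl⟩ : ∃ p, n = p + 1 := ⟨n - 1, by omega⟩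
  have hp : (p : ℝ) ≤ 2 ^ p := by exact_mod_cast Nat.lt_two_pow_self.le
  rw [Nat.add_sub_cancel, le_div_iff₀ (by positivity)]
  calc (p : ℝ) * (2 / m) ^ p * (2 * ε / (m / 2 * m)) * m ^ (p + 1 + 2)
      = p * (2 ^ p * 4 * ε) * m := by
        rw [div_pow]; field_simp; ring
    _ ≤ 2 ^ p * (2 ^ p * 4 * ε) * 1 := by gcongr
    _ ≤ 2 ^ p * (2 ^ p * 16 * ε) * 1 := by gcongr; norm_num
    _ = 2 ^ (2 * (p + 1) + 2) * ε := by ring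
end

section
/- Let n >= 2 and let r_1, ..., r_n be pairwise distinct complex numbers. Set M = max(max_{i,j} |r_i - r_j|, 1), m = min(min_{i != j} |r_i - r_j|, 1), and R = max(max_i |r_i|, 1). Let V be the n-by-n Vandermonde matrix with (i,j) entry r_j^{i-1}, and similarly let Vtilde be the Vandermonde matrix of complex numbers rtilde_1, ..., rtilde_n satisfying |rtilde_i - r_i| <= epsilon for all i, where 0 < epsilon < m/4 (so the rtilde_i are pairwise distinct and Vtilde is invertible). Then every entry satisfies |(Vtilde^{-1})_{i,j} - (V^{-1})_{i,j}| <= (2^{2n+4} * n / m^2) * (M*R/m)^n * epsilon. (Perturbation form of the first bound of Theorem 3.) -/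
open Finset Matrix

theorem Polynomial.iterate_deriv_eval (p : Polynomial ℂ) (k : ℕ) :
    deriv^[k] (fun z => p.eval z) = fun z => (Polynomial.derivative^[k] p).eval z := by
  induction k with
  | zero => rfl
  | succ k ih =>
    rw [Function.iterate_succ_apply', ih, Function.iterate_succ_apply']
    funext z
    exact Polynomial.deriv _

/-- **Cauchy's estimate** for the coefficients of a complex polynomial on the unit circle. -/
theorem Polynomial.norm_coeff_le_of_forall_norm_eq_one {p : Polynomial ℂ} {C : ℝ}
    (hC : ∀ z : ℂ, ‖z‖ = 1 → ‖p.eval z‖ ≤ C) (k : ℕ) : ‖p.coeff k‖ ≤ C := by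
  have h := Complex.norm_iteratedDeriv_le_of_forall_mem_sphere_norm_le (c := 0) (R := 1)
    (f := fun z => p.eval z) k one_pos p.differentiable.diffContOnCl
    (fun z hz => hC z (by simpa using hz))
  rw [iteratedDeriv_eq_iterate, p.iterate_deriv_eval k] at h
  simp only [← Polynomial.coeff_zero_eq_eval_zero, Polynomial.coeff_iterate_derivative, zero_add,
    Nat.descFactorial_self, nsmul_eq_mul, norm_mul, Complex.norm_natCast, one_pow, div_one] at h
  exact le_of_mul_le_mul_left h (by exact_mod_cast k.factorial_pos)

theorem norm_prod_sub_prod_le_of_norm_sub_le {ι : Type*} (s : Finset ι) (f g : ι → ℂ) (B : ι → ℝ)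
    {δ : ℝ} (hf : ∀ k ∈ s, ‖f k‖ ≤ B k) (hg : ∀ k ∈ s, ‖g k‖ ≤ B k)
    (hfg : ∀ k ∈ s, ‖f k - g k‖ ≤ δ * B k) :
    ‖∏ k ∈ s, f k - ∏ k ∈ s, g k‖ ≤ #s * δ * ∏ k ∈ s, B k := by
  classical
  induction s using Finset.induction_on with
  | empty => simp
  | insert a s ha ih =>
    simp only [Finset.forall_mem_insert] at hf hg hfg
    have hB : 0 ≤ B a := (norm_nonneg _).trans hf.1
    have hF : ‖∏ k ∈ s, f k‖ ≤ ∏ k ∈ s, B k := by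
      rw [norm_prod]
      exact Finset.prod_le_prod (fun _ _ => norm_nonneg _) hf.2
    have ih := ih hf.2 hg.2 hfg.2
    rw [Finset.prod_insert ha, Finset.prod_insert ha, Finset.prod_insert ha,
      Finset.card_insert_of_notMem ha]
    calc ‖f a * ∏ k ∈ s, f k - g a * ∏ k ∈ s, g k‖
        = ‖(f a - g a) * ∏ k ∈ s, f k + g a * (∏ k ∈ s, f k - ∏ k ∈ s, g k)‖ := by ring_nf
      _ ≤ ‖f a - g a‖ * ‖∏ k ∈ s, f k‖ + ‖g a‖ * ‖∏ k ∈ s, f k - ∏ k ∈ s, g k‖ := by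
        rw [← norm_mul, ← norm_mul]
        exact norm_add_le _ _
      _ ≤ δ * B a * ∏ k ∈ s, B k + B a * (#s * δ * ∏ k ∈ s, B k) := by
        have h0 : 0 ≤ δ * B a := (norm_nonneg _).trans hfg.1
        exact add_le_add (mul_le_mul hfg.1 hF (norm_nonneg _) h0)
          (mul_le_mul hg.1 ih (norm_nonneg _) hB)
      _ = _ := by push_cast; ring

/-- A packing estimate: few `m`-separated complex numbers have modulus close to `m`. -/
theorem card_le_sixteen_of_separated {ι : Type*} (s : Finset ι) (v : ι → ℂ) {m : ℝ} (hm : 0 < m)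
    (hv : ∀ k ∈ s, ‖v k‖ ≤ 17 / 16 * m)
    (hs : ∀ k ∈ s, ∀ l ∈ s, k ≠ l → m ≤ ‖v k - v l‖) : #s ≤ 16 := by
  have hbox (x : ℝ) (hx : |x| ≤ 17 / 16 * m) : ⌊3 / 2 * x / m⌋ ∈ Finset.Icc (-2 : ℤ) 1 := by
    obtain ⟨h₁, h₂⟩ := abs_le.1 hx
    rw [Finset.mem_Icc, Int.le_floor, ← Int.lt_add_one_iff, Int.floor_lt, le_div_iff₀ hm,
      div_lt_iff₀ hm]
    push_cast
    constructor <;> linarith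
  have hclose (x y : ℝ) (h : ⌊3 / 2 * x / m⌋ = ⌊3 / 2 * y / m⌋) :
      (x - y) ^ 2 ≤ 4 / 9 * m ^ 2 := by
    have h := Int.abs_sub_lt_one_of_floor_eq_floor h
    rw [← sub_div, abs_div, abs_of_pos hm, div_lt_one hm, ← mul_sub, abs_mul] at h
    rw [abs_of_pos (by norm_num : (0 : ℝ) < 3 / 2)] at h
    rw [← sq_abs (x - y)]
    nlinarith [abs_nonneg (x - y)]
  let box : ι → ℤ × ℤ := fun k => (⌊3 / 2 * (v k).re / m⌋, ⌊3 / 2 * (v k).im / m⌋)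
  calc #s ≤ #(Finset.Icc (-2 : ℤ) 1 ×ˢ Finset.Icc (-2 : ℤ) 1) := by
        refine Finset.card_le_card_of_injOn box (fun k hk => ?_) fun k hk l hl hkl => ?_
        · exact Finset.mem_product.2 ⟨hbox _ ((Complex.abs_re_le_norm _).trans (hv k hk)),
            hbox _ ((Complex.abs_im_le_norm _).trans (hv k hk))⟩
        · by_contra hne
          have h := hs k hk l hl hne
          have hre := hclose _ _ (congrArg Prod.fst hkl)
          have him := hclose _ _ (congrArg Prod.snd hkl)
          have hsq := Complex.sq_norm (v k - v l)
          rw [Complex.normSq_apply, Complex.sub_re, Complex.sub_im] at hsq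
          nlinarith
    _ = 16 := by simp

section Factor

variable {a b a' b' z : ℂ} {m R ε : ℝ}

theorem norm_sub_sub_two_mul_le (ha : ‖a' - a‖ ≤ ε) (hb : ‖b' - b‖ ≤ ε) :
    ‖a - b‖ - 2 * ε ≤ ‖a' - b'‖ := by
  have h : ‖a - b‖ ≤ ‖a' - b'‖ + ‖a' - a‖ + ‖b' - b‖ := by
    calc ‖a - b‖ = ‖(a' - b') - (a' - a) + (b' - b)‖ := by ring_nf
      _ ≤ _ := (norm_add_le _ _).trans (add_le_add_left (norm_sub_le _ _) _)
  linarith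

theorem norm_lagrange_factor_le (hm : 0 < m) (hR : 1 ≤ R) (hz : ‖z‖ = 1) (hb : ‖b‖ ≤ R)
    (hab : m ≤ ‖a - b‖) : ‖(z - b) / (a - b)‖ ≤ 4 * R / m := by
  rw [norm_div]
  exact div_le_div₀ (by linarith) ((norm_sub_le _ _).trans (by linarith)) hm hab

theorem norm_perturbed_lagrange_factor_le (hm : 0 < m) (hm1 : m ≤ 1) (hR : 1 ≤ R)
    (hεm : ε < m / 4) (hz : ‖z‖ = 1) (hb : ‖b‖ ≤ R) (hab : m ≤ ‖a - b‖)
    (ha' : ‖a' - a‖ ≤ ε) (hb' : ‖b' - b‖ ≤ ε) :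
    ‖(z - b') / (a' - b')‖ ≤ 4 * R / m * (if ‖a - b‖ ≤ 17 / 16 * m then 9 / 8 else 1) := by
  have hden := norm_sub_sub_two_mul_le ha' hb'
  have hnum : ‖z - b'‖ ≤ 9 / 4 * R := by
    have : ‖b'‖ ≤ ‖b‖ + ‖b' - b‖ := norm_le_norm_add_norm_sub' _ _
    linarith [norm_sub_le z b']
  rw [norm_div]
  split_ifs with h
  · calc _ ≤ 9 / 4 * R / (m / 2) := div_le_div₀ (by linarith) hnum (by linarith) (by linarith)
      _ = _ := by field_simp; norm_num
  · calc _ ≤ 9 / 4 * R / (9 / 16 * m) :=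
          div_le_div₀ (by linarith) hnum (by linarith) (by linarith)
      _ = _ := by field_simp; norm_num

theorem norm_lagrange_factor_sub_le (hm : 0 < m) (hm1 : m ≤ 1) (hR : 1 ≤ R)
    (hε : 0 ≤ ε) (hεm : ε < m / 4) (hz : ‖z‖ = 1) (hb : ‖b‖ ≤ R) (hab : m ≤ ‖a - b‖)
    (ha' : ‖a' - a‖ ≤ ε) (hb' : ‖b' - b‖ ≤ ε) :
    ‖(z - b') / (a' - b') - (z - b) / (a - b)‖ ≤ 5 / 2 * ε / m * (4 * R / m) := by
  have hden := norm_sub_sub_two_mul_le ha' hb'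
  have hD : 0 < ‖a - b‖ := hm.trans_le hab
  have hD' : 0 < ‖a' - b'‖ := by linarith
  have hne := norm_pos_iff.1 hD
  have hne' := norm_pos_iff.1 hD'
  have hid : (z - b') / (a' - b') - (z - b) / (a - b) =
      (-(b' - b)) / (a' - b') + (z - b) * ((b' - b) - (a' - a)) / ((a' - b') * (a - b)) := by
    field_simp
    ring
  have hzb : ‖z - b‖ ≤ 2 * R := (norm_sub_le _ _).trans (by linarith)
  have hdd : ‖(b' - b) - (a' - a)‖ ≤ 2 * ε := (norm_sub_le _ _).trans (by linarith)
  rw [hid]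
  calc _ ≤ ‖b' - b‖ / ‖a' - b'‖
        + ‖z - b‖ * ‖(b' - b) - (a' - a)‖ / (‖a' - b'‖ * ‖a - b‖) := by
        refine (norm_add_le _ _).trans (le_of_eq ?_)
        rw [norm_div, norm_neg, norm_div, norm_mul, norm_mul]
    _ ≤ ε / (m / 2) + 2 * R * (2 * ε) / (m / 2 * m) := by
        gcongr <;> linarith
    _ ≤ ε * R / m / (m / 2) + 2 * R * (2 * ε) / (m / 2 * m) := by
        gcongr
        rw [le_div_iff₀ hm]
        exact mul_le_mul_of_nonneg_left (hm1.trans hR) hε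
    _ = _ := by field_simp; ring

end Factor

theorem Lagrange.eval_basis_eq_prod {n : ℕ} (v : Fin n → ℂ) (i : Fin n) (z : ℂ) :
    (Lagrange.basis univ v i).eval z = ∏ k ∈ univ.erase i, (z - v k) / (v i - v k) := by
  rw [Lagrange.basis, Polynomial.eval_prod]
  refine Finset.prod_congr rfl fun k _ => ?_
  simp [Lagrange.basisDivisor, div_eq_inv_mul]

/-- The rows of an inverse Vandermonde matrix consist of coefficients of Lagrange polynomials. -/
theorem inv_apply_eq_coeff_lagrange_basis {n : ℕ} {v : Fin n → ℂ} (hv : Function.Injective v)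
    {V : Matrix (Fin n) (Fin n) ℂ} (hV : ∀ i j : Fin n, V i j = v j ^ (i : ℕ)) (i j : Fin n) :
    V⁻¹ i j = (Lagrange.basis univ v i).coeff j := by
  have h : (Matrix.of fun i j : Fin n => (Lagrange.basis univ v i).coeff j) * V = 1 := by
    ext i k
    have hdeg : (Lagrange.basis univ v i).natDegree < n := by
      rw [Lagrange.natDegree_basis hv.injOn (mem_univ i), Finset.card_fin]
      have := i.pos
      omega
    have hsum := Polynomial.eval_eq_sum_range' hdeg (v k)
    rw [Finset.sum_range] at hsum
    simp only [Matrix.mul_apply, Matrix.of_apply, hV, ← hsum]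
    rcases eq_or_ne i k with rfl | hik
    · rw [Lagrange.eval_basis_self hv.injOn (mem_univ i), Matrix.one_apply_eq]
    · rw [Lagrange.eval_basis_of_ne hik (mem_univ k), Matrix.one_apply_ne hik]
  rw [Matrix.inv_eq_left_inv h, Matrix.of_apply]

theorem norm_lagrange_basis_coeff_sub_le {n : ℕ} {r rt : Fin n → ℂ} {m R ε : ℝ}
    (hm : 0 < m) (hm1 : m ≤ 1) (hR : 1 ≤ R) (hε : 0 ≤ ε) (hεm : ε < m / 4)
    (hsep : ∀ i j, i ≠ j → m ≤ ‖r i - r j‖) (hrR : ∀ i, ‖r i‖ ≤ R)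
    (hrt : ∀ i, ‖rt i - r i‖ ≤ ε) (i : Fin n) (j : ℕ) :
    ‖(Lagrange.basis univ rt i).coeff j - (Lagrange.basis univ r i).coeff j‖ ≤
      (n - 1 : ℕ) * (5 / 2 * ε / m) * ((4 * R / m) ^ (n - 1) * (9 / 8) ^ 16) := by
  rw [← Polynomial.coeff_sub]
  refine Polynomial.norm_coeff_le_of_forall_norm_eq_one (fun z hz => ?_) j
  rw [Polynomial.eval_sub, Lagrange.eval_basis_eq_prod, Lagrange.eval_basis_eq_prod]
  have hne (k : Fin n) (hk : k ∈ univ.erase i) : m ≤ ‖r i - r k‖ :=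
    hsep i k (Finset.ne_of_mem_erase hk).symm
  have hB : 0 ≤ 4 * R / m := by positivity
  have hone (k : Fin n) : (1 : ℝ) ≤ if ‖r i - r k‖ ≤ 17 / 16 * m then 9 / 8 else 1 := by
    split_ifs <;> norm_num
  have hcard : #((univ.erase i).filter fun k => ‖r i - r k‖ ≤ 17 / 16 * m) ≤ 16 := by
    refine card_le_sixteen_of_separated _ (fun k => r i - r k) hm
      (fun k hk => (Finset.mem_filter.1 hk).2) fun k _ l _ hkl => ?_
    rw [sub_sub_sub_cancel_left]
    exact hsep l k hkl.symm
  refine (norm_prod_sub_prod_le_of_norm_sub_le (univ.erase i) _ _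
    (fun k => 4 * R / m * (if ‖r i - r k‖ ≤ 17 / 16 * m then 9 / 8 else 1))
    (δ := 5 / 2 * ε / m)
    (fun k hk => norm_perturbed_lagrange_factor_le hm hm1 hR hεm hz (hrR k) (hne k hk)
      (hrt i) (hrt k))
    (fun k hk => (norm_lagrange_factor_le hm hR hz (hrR k) (hne k hk)).trans
      (le_mul_of_one_le_right hB (hone k)))
    (fun k hk => (norm_lagrange_factor_sub_le hm hm1 hR hε hεm hz (hrR k) (hne k hk)
      (hrt i) (hrt k)).trans ?_)).trans ?_
  · exact mul_le_mul_of_nonneg_left (le_mul_of_one_le_right hB (hone k)) (by positivity)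
  · rw [Finset.prod_mul_distrib, Finset.prod_const, Finset.prod_ite, Finset.prod_const,
      Finset.prod_const_one, mul_one, Finset.card_erase_of_mem (mem_univ i), Finset.card_fin]
    gcongr
    norm_num

/-- Perturbation form of the first bound of Theorem 3: entrywise distance between
the inverses of the Vandermonde matrices of exact and approximate roots. -/
theorem inverse_vandermonde_perturbation_bound (n : ℕ) (hn : 2 ≤ n)
    (r rt : Fin n → ℂ) (hr : Function.Injective r)
    (M m R : ℝ)
    (hM : M = max (sSup {d : ℝ | ∃ i j : Fin n, d = ‖r i - r j‖}) 1)
    (hm : m = min (sInf {d : ℝ | ∃ i j : Fin n, i ≠ j ∧ d = ‖r i - r j‖}) 1)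
    (hR : R = max (sSup {d : ℝ | ∃ i : Fin n, d = ‖r i‖}) 1)
    (ε : ℝ) (hε0 : 0 < ε) (hεm : ε < m / 4)
    (hrt : ∀ i, ‖rt i - r i‖ ≤ ε)
    (V Vt : Matrix (Fin n) (Fin n) ℂ)
    (hV : ∀ i j : Fin n, V i j = r j ^ (i : ℕ))
    (hVt : ∀ i j : Fin n, Vt i j = rt j ^ (i : ℕ)) :
    ∀ i j : Fin n,
      ‖(Vt⁻¹ - V⁻¹) i j‖ ≤
        2 ^ (2 * n + 4) * n / m ^ 2 * (M * R / m) ^ n * ε := by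
  intro i j
  have hm0 : 0 < m := by linarith
  have hm1 : m ≤ 1 := hm ▸ min_le_right _ _
  have hR1 : 1 ≤ R := hR ▸ le_max_right _ _
  have hM1 : 1 ≤ M := hM ▸ le_max_right _ _
  have hsep (i j : Fin n) (hij : i ≠ j) : m ≤ ‖r i - r j‖ := by
    rw [hm]
    refine (min_le_left _ _).trans (csInf_le ⟨0, ?_⟩ ⟨i, j, hij, rfl⟩)
    rintro _ ⟨i, j, -, rfl⟩
    exact norm_nonneg _
  have hrR (i : Fin n) : ‖r i‖ ≤ R := by
    rw [hR]
    refine le_max_of_le_left (le_csSup ?_ ⟨i, rfl⟩)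
    refine ((Set.finite_range fun i => ‖r i‖).subset ?_).bddAbove
    rintro _ ⟨i, rfl⟩
    exact ⟨i, rfl⟩
  have hrt_inj : Function.Injective rt := by
    intro i j hij
    by_contra hne
    have h := norm_sub_sub_two_mul_le (hrt i) (hrt j)
    rw [hij, sub_self, norm_zero] at h
    linarith [hsep i j hne]
  rw [Matrix.sub_apply, inv_apply_eq_coeff_lagrange_basis hrt_inj hVt,
    inv_apply_eq_coeff_lagrange_basis hr hV]
  refine (norm_lagrange_basis_coeff_sub_le hm0 hm1 hR1 hε0.le hεm hsep hrR hrt i j).trans ?_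
  obtain ⟨k, rfl⟩ : ∃ k, n = k + 1 := ⟨n - 1, by omega⟩
  rw [Nat.add_sub_cancel]
  have hpow : R ^ k ≤ (M * R) ^ (k + 1) :=
    calc R ^ k ≤ (M * R) ^ k := by
          gcongr
          exact le_mul_of_one_le_left (by linarith) hM1
      _ ≤ (M * R) ^ (k + 1) := pow_le_pow_right₀ (one_le_mul_of_one_le_of_one_le hM1 hR1) k.le_succ
  have hmm : 1 ≤ 1 / m ^ 2 := by
    rw [le_div_iff₀ (by positivity), one_mul]
    exact pow_le_one₀ hm0.le hm1
  calc (k : ℝ) * (5 / 2 * ε / m) * ((4 * R / m) ^ k * (9 / 8) ^ 16)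
      = 5 / 2 * (9 / 8) ^ 16 * 4 ^ k * k * (R ^ k / m ^ (k + 1)) * ε := by
        rw [div_pow, mul_pow]
        field_simp
        ring
    _ ≤ 64 * 4 ^ k * (k + 1 : ℕ) * ((M * R) ^ (k + 1) / m ^ (k + 1)) * ε := by
        gcongr
        · norm_num
        · exact k.le_succ
    _ ≤ 64 * 4 ^ k * (k + 1 : ℕ) * ((M * R) ^ (k + 1) / m ^ (k + 1)) * ε * (1 / m ^ 2) :=
        le_mul_of_one_le_right (by positivity) hmm
    _ = 2 ^ (2 * (k + 1) + 4) * (k + 1 : ℕ) / m ^ 2 * (M * R / m) ^ (k + 1) * ε := by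
        have h4 : (2 : ℝ) ^ (2 * (k + 1) + 4) = 64 * 4 ^ k := by
          rw [pow_add, pow_mul, pow_succ]
          norm_num
          ring
        rw [div_pow, h4]
        ring
end

section
/- Let n >= 2 and let r_1, ..., r_n be pairwise distinct complex numbers. Set M = max(max_{i,j} |r_i - r_j|, 1), m = min(min_{i != j} |r_i - r_j|, 1), and R = max(max_i |r_i|, 1). Let V be the n-by-n Vandermonde matrix with (i,j) entry r_j^{i-1}. Then every entry of the inverse satisfies |(V^{-1})_{i,j}| <= 2n * (R*M/m)^n. (Second bound of Theorem 3.) -/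
open Finset Matrix

/-- The tangent-line inequality driving the inductive proof of Maclaurin's inequality. -/
lemma maclaurin_tangent {N a b : ℝ} (ha : 0 ≤ a) (hb : 0 ≤ b) (k : ℕ) (hk : (k : ℝ) + 1 ≤ N) :
    N * a * b ^ k - (N - 1) * b ^ (k + 1) ≤ a ^ (k + 1) + (N - (k + 1)) * a ^ k * (a - b) := by
  induction k with
  | zero => simp; nlinarith
  | succ k ih =>
    push_cast at hk ⊢
    have h1 := mul_le_mul_of_nonneg_left (ih (by linarith)) hb
    have h2 : 0 ≤ (N - (k + 1)) * a ^ k * (a - b) ^ 2 :=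
      mul_nonneg (mul_nonneg (by linarith) (pow_nonneg ha k)) (sq_nonneg _)
    have e1 : a ^ (k + 1 + 1) + (N - (k + 1 + 1)) * a ^ (k + 1) * (a - b)
        - (N * a * b ^ (k + 1) - (N - 1) * b ^ (k + 1 + 1))
        = (b * (a ^ (k + 1) + (N - (k + 1)) * a ^ k * (a - b))
          - b * (N * a * b ^ k - (N - 1) * b ^ (k + 1)))
          + (N - (k + 1)) * a ^ k * (a - b) ^ 2 := by ring
    linarith

open Polynomial in
/-- Coefficients of `∏ (X + aᵢ)` in terms of those with one factor removed. -/
lemma sub_mul_coeff_prod_X_add_C {ι : Type*} [DecidableEq ι] (s : Finset ι) (a : ι → ℝ) (j : ℕ) :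
    ((#s : ℝ) - j) * (∏ i ∈ s, (X + C (a i))).coeff j
      = ∑ i ∈ s, a i * (∏ l ∈ s.erase i, (X + C (a l))).coeff j := by
  have hX : X * derivative (∏ i ∈ s, (X + C (a i)))
      = ∑ i ∈ s, ((∏ l ∈ s, (X + C (a l))) - C (a i) * ∏ l ∈ s.erase i, (X + C (a l))) := by
    rw [derivative_prod_finset, Finset.mul_sum]
    refine Finset.sum_congr rfl fun i hi => ?_
    rw [← Finset.mul_prod_erase s _ hi]
    simp
    ring
  have hc := congrArg (fun p => p.coeff j) hX
  have hl : (X * derivative (∏ i ∈ s, (X + C (a i)))).coeff j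
      = (j : ℝ) * (∏ i ∈ s, (X + C (a i))).coeff j := by
    cases j with
    | zero => simp
    | succ j => rw [coeff_X_mul, coeff_derivative]; push_cast; ring
  simp only [hl, finsetSum_coeff, coeff_sub, coeff_C_mul, Finset.sum_sub_distrib,
    Finset.sum_const, nsmul_eq_mul, coeff_natCast_mul] at hc
  linarith

open Polynomial in
/-- Maclaurin's inequality between an elementary symmetric mean and the arithmetic mean. -/
lemma coeff_prod_X_add_C_le {ι : Type*} [DecidableEq ι] (N : ℕ) :
    ∀ (s : Finset ι) (a : ι → ℝ), #s = N → (∀ i ∈ s, 0 ≤ a i) → ∀ j ≤ N,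
      (∏ i ∈ s, (X + C (a i))).coeff j ≤ N.choose j * ((∑ i ∈ s, a i) / N) ^ (N - j) := by
  induction N with
  | zero =>
    intro s a hs _ j hj
    obtain rfl := Finset.card_eq_zero.1 hs
    obtain rfl : j = 0 := by omega
    simp
  | succ N ih =>
    intro s a hs ha j hj
    rcases Nat.lt_or_ge N j with h | h
    · obtain rfl : j = N + 1 := by omega
      have hm : (∏ i ∈ s, (X + C (a i))).Monic := monic_prod_of_monic _ _ fun i _ => monic_X_add_C _
      have hd : (∏ i ∈ s, (X + C (a i))).natDegree = N + 1 := by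
        rw [natDegree_prod_of_monic _ _ fun i _ => monic_X_add_C _]
        simp [hs]
      have := hm.coeff_natDegree
      rw [hd] at this
      simp [this]
    · obtain ⟨k, rfl⟩ := Nat.exists_eq_add_of_le h
      set A := ∑ i ∈ s, a i with hA
      have hA0 : 0 ≤ A := Finset.sum_nonneg ha
      have hrec := sub_mul_coeff_prod_X_add_C s a j
      have hterm : ∀ i ∈ s, a i * (∏ l ∈ s.erase i, (X + C (a l))).coeff j
          ≤ (j + k).choose j * (a i * ((A - a i) / ((j + k : ℕ) : ℝ)) ^ k) := by
        intro i hi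
        have h1 := ih (s.erase i) a (by rw [Finset.card_erase_of_mem hi, hs]; omega)
          (fun l hl => ha l (Finset.mem_of_mem_erase hl)) j (by omega)
        have h2 : ∑ l ∈ s.erase i, a l = A - a i := by
          rw [hA, ← Finset.add_sum_erase s a hi]; ring
        rw [h2, Nat.add_sub_cancel_left] at h1
        calc _ ≤ a i * ((j + k).choose j * ((A - a i) / ((j + k : ℕ) : ℝ)) ^ k) :=
              mul_le_mul_of_nonneg_left h1 (ha i hi)
          _ = _ := by ring
      set α := A / ((j + k + 1 : ℕ) : ℝ) with hα
      have hn0 : (0 : ℝ) < ((j + k + 1 : ℕ) : ℝ) := by positivity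
      have hAα : A = ((j + k + 1 : ℕ) : ℝ) * α := by rw [hα]; field_simp
      have hα0 : 0 ≤ α := by positivity
      clear_value α
      have htan : ∀ i ∈ s, a i * ((A - a i) / ((j + k : ℕ) : ℝ)) ^ k
          ≤ α ^ (k + 1) + j * α ^ k * (α - (A - a i) / ((j + k : ℕ) : ℝ)) := by
        intro i hi
        have hle : a i ≤ A := Finset.single_le_sum ha hi
        rcases Nat.eq_zero_or_pos (j + k) with h0 | h0
        · obtain ⟨rfl, rfl⟩ : j = 0 ∧ k = 0 := by omega
          simp at hAα ⊢
          linarith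
        · have hp : (0 : ℝ) < ((j + k : ℕ) : ℝ) := by exact_mod_cast h0
          have hb : 0 ≤ (A - a i) / ((j + k : ℕ) : ℝ) := div_nonneg (by linarith) hp.le
          have := maclaurin_tangent (N := ((j + k + 1 : ℕ) : ℝ)) hα0 hb k
            (by push_cast; linarith [(Nat.cast_nonneg j : (0 : ℝ) ≤ j)])
          set b := (A - a i) / ((j + k : ℕ) : ℝ) with hbdef
          have hai : a i = ((j + k + 1 : ℕ) : ℝ) * α - ((j + k : ℕ) : ℝ) * b := by
            rw [← hAα, hbdef]; field_simp; ring
          rw [hai]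
          push_cast at this ⊢
          calc _ = (j + k + 1 : ℝ) * α * b ^ k - (j + k + 1 - 1) * b ^ (k + 1) := by ring
            _ ≤ _ := this
            _ = _ := by ring
      have hsumb : ∑ i ∈ s, (j * α ^ k * (α - (A - a i) / ((j + k : ℕ) : ℝ))) = 0 := by
        rcases Nat.eq_zero_or_pos (j + k) with h0 | h0
        · obtain ⟨rfl, rfl⟩ : j = 0 ∧ k = 0 := by omega
          simp
        · have hp : (0 : ℝ) < ((j + k : ℕ) : ℝ) := by exact_mod_cast h0
          rw [← Finset.mul_sum, Finset.sum_sub_distrib, ← Finset.sum_div,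
            Finset.sum_sub_distrib (f := fun _ => A),
            ← hA, Finset.sum_const, Finset.sum_const, hs, nsmul_eq_mul, nsmul_eq_mul, ← hAα]
          have : A - (((j + k + 1 : ℕ) : ℝ) * A - A) / ((j + k : ℕ) : ℝ) = 0 := by
            push_cast at hp ⊢
            field_simp
            ring
          rw [this, mul_zero]
      have hsum : ∑ i ∈ s, a i * (∏ l ∈ s.erase i, (X + C (a l))).coeff j
          ≤ (j + k).choose j * (((j + k + 1 : ℕ) : ℝ) * α ^ (k + 1)) := by
        calc _ ≤ ∑ i ∈ s, ((j + k).choose j : ℝ) * (α ^ (k + 1)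
                + j * α ^ k * (α - (A - a i) / ((j + k : ℕ) : ℝ))) :=
              Finset.sum_le_sum fun i hi => (hterm i hi).trans
                (mul_le_mul_of_nonneg_left (htan i hi) (Nat.cast_nonneg _))
          _ = _ := by
              rw [← Finset.mul_sum, Finset.sum_add_distrib, hsumb, Finset.sum_const, hs,
                nsmul_eq_mul, add_zero]
      have hch : ((k : ℝ) + 1) * ((j + k + 1).choose j) = (j + k + 1 : ℕ) * ((j + k).choose j) := by
        have := Nat.choose_mul_succ_eq (j + k) j
        rw [show j + k + 1 - j = k + 1 by omega] at this
        have h3 : (((j + k).choose j : ℕ) : ℝ) * ((j + k + 1 : ℕ) : ℝ)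
          = (((j + k + 1).choose j : ℕ) : ℝ) * ((k + 1 : ℕ) : ℝ) := by exact_mod_cast this
        push_cast at h3 ⊢
        linarith
      rw [← hrec, hs] at hsum
      rw [show j + k + 1 - j = k + 1 by omega]
      have hk : (0 : ℝ) < k + 1 := by positivity
      refine le_of_mul_le_mul_left ?_ hk
      calc ((k : ℝ) + 1) * (∏ i ∈ s, (X + C (a i))).coeff j
          = (((j + k + 1 : ℕ) : ℝ) - j) * (∏ i ∈ s, (X + C (a i))).coeff j := by push_cast; ring
        _ ≤ _ := hsum
        _ = ((j + k + 1 : ℕ) * ((j + k).choose j)) * α ^ (k + 1) := by ring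
        _ = _ := by rw [← hch]; ring

open Polynomial in
/-- The coefficients of a monic complex polynomial are dominated by those of the polynomial whose
roots are the negated moduli. -/
lemma norm_coeff_prod_X_sub_C_le {ι : Type*} (s : Finset ι) (z : ι → ℂ) (j : ℕ) :
    ‖(∏ i ∈ s, (X - C (z i))).coeff j‖ ≤ (∏ i ∈ s, (X + C ‖z i‖)).coeff j := by
  classical
  induction s using Finset.induction_on generalizing j with
  | empty => by_cases h : j = 0 <;> simp [coeff_one, h]
  | insert i s hi ih =>
    rw [Finset.prod_insert hi, Finset.prod_insert hi, sub_mul, add_mul, coeff_sub, coeff_add,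
      coeff_C_mul, coeff_C_mul]
    refine (norm_sub_le _ _).trans (add_le_add ?_ ?_)
    · cases j with
      | zero => simp
      | succ j => simpa using ih j
    · rw [norm_mul]
      exact mul_le_mul_of_nonneg_left (ih j) (norm_nonneg _)

/-- Disjoint intervals `[uₖ - wₖ, uₖ + wₖ]` inside `[a, b]` have total length at most `b - a`. -/
lemma sum_two_mul_le_of_separated {ι : Type*} (s : Finset ι) (u w : ι → ℝ) (a : ℝ)
    (hsep : ∀ k ∈ s, ∀ l ∈ s, k ≠ l → w k + w l ≤ |u k - u l|)
    (ha : ∀ k ∈ s, a ≤ u k - w k) :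
    ∀ b, a ≤ b → (∀ k ∈ s, u k + w k ≤ b) → 2 * ∑ k ∈ s, w k ≤ b - a := by
  classical
  induction s using Finset.induction_on_max_value u with
  | empty => intro b hab _; simpa using hab
  | insert k s hk hmax ih =>
    intro b hab hb
    have h1 := ih (fun i hi l hl => hsep i (mem_insert_of_mem hi) l (mem_insert_of_mem hl))
      (fun i hi => ha i (mem_insert_of_mem hi)) (u k - w k) (ha k (mem_insert_self _ _)) ?_
    · rw [Finset.sum_insert hk]
      linarith [hb k (mem_insert_self _ _)]
    · intro l hl
      have := hsep k (mem_insert_self _ _) l (mem_insert_of_mem hl) (by rintro rfl; exact hk hl)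
      rw [abs_of_nonneg (by linarith [hmax l hl])] at this
      linarith

lemma abs_le_of_neg_le_cos {δ : ℝ} (hδ : |δ| ≤ 3.56) (hcos : -0.203 ≤ Real.cos δ) :
    |δ| ≤ 1.78 := by
  by_contra! h
  rw [← Real.cos_abs] at hcos
  have p1 := Real.pi_gt_d4
  have p2 := Real.pi_lt_d4
  have hx : |(|δ| - Real.pi)| ≤ 1.3616 := abs_le.2 ⟨by linarith, by linarith⟩
  have h1 : Real.cos (|δ| - Real.pi) = -Real.cos |δ| := Real.cos_sub_pi _
  have h2 : Real.sin 0.209 ≤ Real.cos (|δ| - Real.pi) := by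
    rw [← Real.cos_abs, ← Real.sin_pi_div_two_sub]
    apply Real.sin_le_sin_of_le_of_le_pi_div_two
    · linarith
    · linarith [abs_nonneg (|δ| - Real.pi)]
    · linarith
  have h3 := Real.sin_gt_sub_cube (x := 0.209) (by norm_num)
  norm_num at h3 h2 hcos
  linarith

lemma normSq_polar_sub (a b u v : ℝ) :
    ‖(a : ℂ) * Complex.exp (u * Complex.I) - b * Complex.exp (v * Complex.I)‖ ^ 2
      = (a - b) ^ 2 + 2 * a * b * (1 - Real.cos (u - v)) := by
  rw [← Complex.normSq_eq_norm_sq, Complex.normSq_apply, Real.cos_sub]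
  simp [Complex.exp_ofReal_mul_I_re, Complex.exp_ofReal_mul_I_im]
  linear_combination a ^ 2 * Real.sin_sq_add_cos_sq u + b ^ 2 * Real.sin_sq_add_cos_sq v

lemma norm_polar_sub_le {a b u v : ℝ} (ha : 0 ≤ a) (hb : 0 ≤ b) (ha1 : a ≤ 1) (hb1 : b ≤ 1) :
    ‖(a : ℂ) * Complex.exp (u * Complex.I) - b * Complex.exp (v * Complex.I)‖
      ≤ |a - b| + |u - v| := by
  refine abs_le_of_sq_le_sq' ?_ (by positivity) |>.2
  rw [normSq_polar_sub]
  have h1 := Real.one_sub_sq_div_two_le_cos (x := u - v)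
  have h2 : a * b ≤ 1 := mul_le_one₀ ha1 hb hb1
  have h3 : 0 ≤ a * b := mul_nonneg ha hb
  have h4 : 2 * a * b * (1 - Real.cos (u - v)) ≤ (u - v) ^ 2 := by
    nlinarith [Real.cos_le_one (u - v), sq_nonneg (u - v)]
  rw [← sq_abs (a - b)]
  rw [← sq_abs (u - v)] at h4
  nlinarith [mul_nonneg (abs_nonneg (a - b)) (abs_nonneg (u - v))]

/-- Separated points of small diameter in the unit disc cannot all be close to the unit circle. -/
lemma card_sub_one_mul_le_sum_depth {ι : Type*} (s : Finset ι) (z : ι → ℂ) {μ : ℝ}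
    (hμ0 : 0 ≤ μ) (hμ : μ ≤ 0.71) (hz : ∀ k ∈ s, ‖z k‖ ≤ 1)
    (hdiam : ∀ k ∈ s, ∀ l ∈ s, ‖z k - z l‖ ≤ 1)
    (hsep : ∀ k ∈ s, ∀ l ∈ s, k ≠ l → μ ≤ ‖z k - z l‖) :
    ((#s : ℝ) - 1) * μ - 1.78 ≤ 2 * ∑ k ∈ s, (1 - ‖z k‖) := by
  classical
  set T := s.filter fun k => 1 - ‖z k‖ < μ / 2 with hT
  suffices h : 2 * ∑ k ∈ T, (μ / 2 - (1 - ‖z k‖)) ≤ μ + 1.78 by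
    have h1 : ∑ k ∈ s, (μ / 2 - (1 - ‖z k‖)) ≤ ∑ k ∈ T, (μ / 2 - (1 - ‖z k‖)) := by
      rw [hT, Finset.sum_filter]
      refine Finset.sum_le_sum fun k _ => ?_
      split_ifs <;> linarith
    rw [Finset.sum_sub_distrib, Finset.sum_const, nsmul_eq_mul] at h1
    linarith
  rcases T.eq_empty_or_nonempty with h0 | ⟨k₀, hk₀⟩
  · rw [h0]; simp; linarith
  have hTs : ∀ k ∈ T, k ∈ s ∧ 1 - ‖z k‖ < μ / 2 := fun k hk => Finset.mem_filter.1 hk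
  have hbig : ∀ k ∈ T, 0.645 ≤ ‖z k‖ := fun k hk => by linarith [(hTs k hk).2]
  set u : ι → ℝ := fun k => (z k / z k₀).arg with hu
  have hz0 : z k₀ ≠ 0 := by
    intro h; have := hbig k₀ hk₀; rw [h, norm_zero] at this; norm_num at this
  have hn0 : ‖z k₀‖ ≠ 0 := norm_ne_zero_iff.2 hz0
  have hdist : ∀ k l, ‖z k - z l‖ = ‖(‖z k‖ : ℂ) * Complex.exp (u k * Complex.I)
      - ‖z l‖ * Complex.exp (u l * Complex.I)‖ := by
    have hp : ∀ k, z k * ((‖z k₀‖ : ℂ) / z k₀) = (‖z k‖ : ℂ) * Complex.exp (u k * Complex.I) := by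
      intro k
      have h1 := Complex.norm_mul_exp_arg_mul_I (z k / z k₀)
      have hc : (‖z k₀‖ : ℂ) ≠ 0 := by exact_mod_cast hn0
      rw [norm_div] at h1
      push_cast at h1
      calc z k * ((‖z k₀‖ : ℂ) / z k₀) = ‖z k₀‖ * (z k / z k₀) := by ring
        _ = ‖z k₀‖ * ((‖z k‖ / ‖z k₀‖ : ℂ) * Complex.exp (u k * Complex.I)) := by rw [h1]
        _ = _ := by field_simp
    intro k l
    rw [← hp, ← hp, ← sub_mul, norm_mul, norm_div]
    simp [hn0]
  have hcos : ∀ k ∈ T, ∀ l ∈ T, -0.203 ≤ Real.cos (u k - u l) := by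
    intro k hk l hl
    have h1 := hdiam k (hTs k hk).1 l (hTs l hl).1
    have h2 := normSq_polar_sub ‖z k‖ ‖z l‖ (u k) (u l)
    rw [← hdist] at h2
    have h3 : 0.645 * 0.645 ≤ ‖z k‖ * ‖z l‖ :=
      mul_le_mul (hbig k hk) (hbig l hl) (by norm_num) (norm_nonneg _)
    have h4 : ‖z k - z l‖ ^ 2 ≤ 1 := pow_le_one₀ (norm_nonneg _) h1
    by_contra! h
    nlinarith [sq_nonneg (‖z k‖ - ‖z l‖)]
  have hu0 : u k₀ = 0 := by simp [hu]
  have hangle0 : ∀ k ∈ T, |u k| ≤ 1.78 := by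
    intro k hk
    have := hcos k hk k₀ hk₀
    rw [hu0, sub_zero] at this
    refine abs_le_of_neg_le_cos ?_ this
    exact (Complex.abs_arg_le_pi _).trans (by linarith [Real.pi_lt_d2])
  have hangle : ∀ k ∈ T, ∀ l ∈ T, |u k - u l| ≤ 1.78 := by
    intro k hk l hl
    refine abs_le_of_neg_le_cos ?_ (hcos k hk l hl)
    have := abs_sub (u k) (u l)
    linarith [hangle0 k hk, hangle0 l hl]
  obtain ⟨kmin, hkmin, hmin⟩ := T.exists_min_image u ⟨k₀, hk₀⟩
  have := sum_two_mul_le_of_separated T u (fun k => μ / 2 - (1 - ‖z k‖)) (u kmin - μ / 2)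
    ?_ ?_ (u kmin + 1.78 + μ / 2) (by linarith) ?_
  · linarith
  · intro k hk l hl hkl
    have h1 := hsep k (hTs k hk).1 l (hTs l hl).1 hkl
    rw [hdist] at h1
    have h2 := norm_polar_sub_le (u := u k) (v := u l) (norm_nonneg (z k)) (norm_nonneg (z l))
      (hz k (hTs k hk).1) (hz l (hTs l hl).1)
    have h3 : |‖z k‖ - ‖z l‖| ≤ (1 - ‖z k‖) + (1 - ‖z l‖) :=
      abs_le.2 ⟨by linarith [hz l (hTs l hl).1], by linarith [hz k (hTs k hk).1]⟩
    linarith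
  · intro k hk
    linarith [hmin k hk, hz k (hTs k hk).1]
  · intro k hk
    linarith [(abs_le.1 (hangle k hk kmin hkmin)).2, hz k (hTs k hk).1]

lemma integral_max_sq_sub_normSq {a : ℝ} (ha : 0 ≤ a) :
    ∫ z : ℂ, max (a ^ 2 - ‖z‖ ^ 2) 0 = Real.pi * a ^ 4 / 2 := by
  have h := MeasureTheory.integral_fun_norm_addHaar (E := ℂ) MeasureTheory.volume
    (fun y => max (a ^ 2 - y ^ 2) 0)
  rw [h, Complex.finrank_real_complex, MeasureTheory.measureReal_def, Complex.volume_ball]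
  have h1 : ∫ y in Set.Ioi (0 : ℝ), y ^ (2 - 1) • max (a ^ 2 - y ^ 2) 0
      = ∫ y in (0 : ℝ)..a, y * (a ^ 2 - y ^ 2) := by
    rw [intervalIntegral.integral_of_le ha,
      MeasureTheory.setIntegral_eq_of_subset_of_forall_sdiff_eq_zero
        (s := Set.Ioc 0 a) measurableSet_Ioi Set.Ioc_subset_Ioi_self]
    · refine MeasureTheory.setIntegral_congr_fun measurableSet_Ioc fun y hy => ?_
      have : y ^ 2 ≤ a ^ 2 := pow_le_pow_left₀ hy.1.le hy.2 2
      simp [max_eq_left (sub_nonneg.2 this)]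
    · intro y hy
      rw [Set.mem_sdiff] at hy
      have hay : a ≤ y := by
        by_contra! hc
        exact hy.2 ⟨hy.1, hc.le⟩
      have : a ^ 2 ≤ y ^ 2 := pow_le_pow_left₀ ha hay 2
      simp [max_eq_right (sub_nonpos.2 this)]
  have h2 : ∫ y in (0 : ℝ)..a, y * (a ^ 2 - y ^ 2) = a ^ 4 / 4 := by
    have : ∀ y ∈ Set.uIcc 0 a, HasDerivAt (fun y : ℝ => a ^ 2 * y ^ 2 / 2 - y ^ 4 / 4)
        (y * (a ^ 2 - y ^ 2)) y := by
      intro y _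
      have := (((hasDerivAt_pow 2 y).const_mul (a ^ 2)).div_const 2).sub
        ((hasDerivAt_pow 4 y).div_const 4)
      refine this.congr_deriv ?_
      push_cast
      ring
    rw [intervalIntegral.integral_eq_sub_of_hasDerivAt this
      (Continuous.intervalIntegrable (by fun_prop) _ _)]
    ring
  rw [h1, h2]
  simp
  ring

lemma setIntegral_ball_sub_normSq (A : ℝ) (c : ℂ) {ρ : ℝ} (hρ : 0 ≤ ρ) :
    ∫ z in Metric.ball c ρ, (A - ‖z‖ ^ 2) = Real.pi * ρ ^ 2 * (A - ‖c‖ ^ 2 - ρ ^ 2 / 2) := by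
  have hint : ∀ (f : ℂ → ℝ), Continuous f →
      MeasureTheory.IntegrableOn f (Metric.ball 0 ρ) := fun f hf =>
    (hf.continuousOn.integrableOn_compact (isCompact_closedBall 0 ρ)).mono_set
      Metric.ball_subset_closedBall
  have hvol : MeasureTheory.volume.real (Metric.ball (0 : ℂ) ρ) = Real.pi * ρ ^ 2 := by
    rw [MeasureTheory.measureReal_def, Complex.volume_ball]
    simp [hρ]
    ring
  have hconst : ∀ B : ℝ, ∫ _ in Metric.ball (0 : ℂ) ρ, B = Real.pi * ρ ^ 2 * B := by
    intro B
    rw [MeasureTheory.setIntegral_const, hvol, smul_eq_mul]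
  have hsq : ∫ z in Metric.ball (0 : ℂ) ρ, ‖z‖ ^ 2 = Real.pi * ρ ^ 4 / 2 := by
    have h1 : ∫ z in Metric.ball (0 : ℂ) ρ, (ρ ^ 2 - ‖z‖ ^ 2) = Real.pi * ρ ^ 4 / 2 := by
      rw [← integral_max_sq_sub_normSq hρ,
        ← MeasureTheory.setIntegral_eq_integral_of_forall_compl_eq_zero (s := Metric.ball (0 : ℂ) ρ)
          (f := fun z => max (ρ ^ 2 - ‖z‖ ^ 2) 0)]
      · refine MeasureTheory.setIntegral_congr_fun Metric.isOpen_ball.measurableSet fun z hz => ?_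
        have : ‖z‖ ^ 2 ≤ ρ ^ 2 := pow_le_pow_left₀ (norm_nonneg _) (mem_ball_zero_iff.1 hz).le 2
        simp [max_eq_left (sub_nonneg.2 this)]
      · intro z hz
        have : ρ ^ 2 ≤ ‖z‖ ^ 2 := pow_le_pow_left₀ hρ (by simpa using hz) 2
        exact max_eq_right (sub_nonpos.2 this)
    rw [MeasureTheory.integral_sub (hint _ (by fun_prop)) (hint _ (by fun_prop)), hconst] at h1
    linarith
  have hshift : ∫ z in Metric.ball c ρ, (A - ‖z‖ ^ 2)
      = ∫ w in Metric.ball (0 : ℂ) ρ, (A - ‖c + w‖ ^ 2) := by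
    rw [← MeasureTheory.integral_indicator Metric.isOpen_ball.measurableSet,
      ← MeasureTheory.integral_indicator Metric.isOpen_ball.measurableSet,
      ← MeasureTheory.integral_add_left_eq_self _ c]
    refine MeasureTheory.integral_congr_ae (Filter.Eventually.of_forall fun w => ?_)
    simp [Set.indicator]
  have hflip : ∫ w in Metric.ball (0 : ℂ) ρ, (A - ‖c + w‖ ^ 2)
      = ∫ w in Metric.ball (0 : ℂ) ρ, (A - ‖c - w‖ ^ 2) := by
    rw [← MeasureTheory.integral_indicator Metric.isOpen_ball.measurableSet,
      ← MeasureTheory.integral_indicator Metric.isOpen_ball.measurableSet,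
      ← MeasureTheory.integral_neg_eq_self]
    refine MeasureTheory.integral_congr_ae (Filter.Eventually.of_forall fun w => ?_)
    simp [Set.indicator, sub_eq_add_neg]
  have hadd : (∫ w in Metric.ball (0 : ℂ) ρ, (A - ‖c + w‖ ^ 2))
      + ∫ w in Metric.ball (0 : ℂ) ρ, (A - ‖c - w‖ ^ 2)
      = 2 * ((∫ _ in Metric.ball (0 : ℂ) ρ, (A - ‖c‖ ^ 2))
        - ∫ w in Metric.ball (0 : ℂ) ρ, ‖w‖ ^ 2) := by
    rw [← MeasureTheory.integral_add (hint _ (by fun_prop)) (hint _ (by fun_prop)),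
      ← MeasureTheory.integral_sub (hint _ (by fun_prop)) (hint _ (by fun_prop)),
      ← MeasureTheory.integral_const_mul]
    congr 1
    ext w
    have := parallelogram_law_with_norm ℝ c w
    linarith
  rw [hconst, hsq] at hadd
  rw [hshift]
  linarith

/-- A paraboloid integrated over disjoint discs is at most its total volume above height zero. -/
lemma sum_sub_normSq_mul_le {ι : Type*} (s : Finset ι) (c : ι → ℂ) {m A : ℝ} (hm : 0 ≤ m)
    (hA : 0 ≤ A) (hsep : ∀ k ∈ s, ∀ l ∈ s, k ≠ l → m ≤ ‖c k - c l‖) :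
    (∑ k ∈ s, (A - ‖c k‖ ^ 2 - m ^ 2 / 8)) * m ^ 2 ≤ 2 * A ^ 2 := by
  have hmeas : ∀ k ∈ s, MeasurableSet (Metric.ball (c k) (m / 2)) :=
    fun k _ => Metric.isOpen_ball.measurableSet
  have hdisj : (s : Set ι).Pairwise
      (Function.onFun Disjoint fun k => Metric.ball (c k) (m / 2)) := by
    intro k hk l hl hkl
    refine Metric.ball_disjoint_ball ?_
    rw [dist_eq_norm]
    linarith [hsep k hk l hl hkl]
  have hint : ∀ f : ℂ → ℝ, Continuous f → ∀ k ∈ s,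
      MeasureTheory.IntegrableOn f (Metric.ball (c k) (m / 2)) := fun f hf k _ =>
    (hf.continuousOn.integrableOn_compact (isCompact_closedBall _ _)).mono_set
      Metric.ball_subset_closedBall
  have hI := integral_max_sq_sub_normSq (Real.sqrt_nonneg A)
  rw [Real.sq_sqrt hA, show √A ^ 4 = (√A ^ 2) ^ 2 by ring, Real.sq_sqrt hA] at hI
  have hcont : Continuous fun z : ℂ => max (A - ‖z‖ ^ 2) 0 := by fun_prop
  have hcpt : HasCompactSupport fun z : ℂ => max (A - ‖z‖ ^ 2) 0 := by
    refine HasCompactSupport.intro (isCompact_closedBall 0 (√A)) fun z hz => ?_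
    have h1 : √A ≤ ‖z‖ := by
      by_contra! h
      exact hz (by simpa using h.le)
    have h2 := pow_le_pow_left₀ (Real.sqrt_nonneg A) h1 2
    rw [Real.sq_sqrt hA] at h2
    exact max_eq_right (sub_nonpos.2 h2)
  have hcomp : ∑ k ∈ s, ∫ z in Metric.ball (c k) (m / 2), (A - ‖z‖ ^ 2) ≤ Real.pi * A ^ 2 / 2 := by
    rw [← hI]
    calc _ ≤ ∑ k ∈ s, ∫ z in Metric.ball (c k) (m / 2), max (A - ‖z‖ ^ 2) 0 :=
          Finset.sum_le_sum fun k hk => MeasureTheory.setIntegral_mono (hint _ (by fun_prop) k hk)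
            (hint _ hcont k hk) fun z => le_max_left _ _
      _ = ∫ z in ⋃ k ∈ s, Metric.ball (c k) (m / 2), max (A - ‖z‖ ^ 2) 0 :=
          (MeasureTheory.integral_biUnion_finset s hmeas hdisj (hint _ hcont)).symm
      _ ≤ _ := MeasureTheory.setIntegral_le_integral (hcont.integrable_of_hasCompactSupport hcpt)
          (Filter.Eventually.of_forall fun z => le_max_right _ _)
  have hterm : ∀ k ∈ s, ∫ z in Metric.ball (c k) (m / 2), (A - ‖z‖ ^ 2)
      = Real.pi * m ^ 2 / 4 * (A - ‖c k‖ ^ 2 - m ^ 2 / 8) := by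
    intro k _
    rw [setIntegral_ball_sub_normSq A (c k) (by linarith : (0 : ℝ) ≤ m / 2)]
    ring
  rw [Finset.sum_congr rfl hterm, ← Finset.mul_sum] at hcomp
  have hpi := Real.pi_pos
  refine le_of_mul_le_mul_left ?_ (by positivity : 0 < Real.pi / 4)
  linarith

/-- A planar set of diameter at most `1` has at most `4 / m ^ 2` points at mutual
distances at least `m`. -/
lemma card_mul_sq_le_four {ι : Type*} (s : Finset ι) (c : ι → ℂ) {m : ℝ} (hm : 0 < m)
    (hs : 2 ≤ #s) (hdiam : ∀ k ∈ s, ∀ l ∈ s, ‖c k - c l‖ ≤ 1)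
    (hsep : ∀ k ∈ s, ∀ l ∈ s, k ≠ l → m ≤ ‖c k - c l‖) : #s * m ^ 2 ≤ 4 := by
  classical
  set n := (#s : ℝ) with hn
  have hn2 : (2 : ℝ) ≤ n := by rw [hn]; exact_mod_cast hs
  set p : ℂ := (∑ k ∈ s, c k) / #s with hp
  have hp0 : ∑ k ∈ s, (c k - p) = 0 := by
    have : (#s : ℂ) ≠ 0 := by exact_mod_cast (by omega : #s ≠ 0)
    rw [Finset.sum_sub_distrib, Finset.sum_const, nsmul_eq_mul, hp]
    field_simp
    ring
  have hvar : ∑ k ∈ s, ∑ l ∈ s, ‖c k - c l‖ ^ 2 = 2 * n * ∑ k ∈ s, ‖c k - p‖ ^ 2 := by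
    have h1 : ∀ k l, ‖c k - c l‖ ^ 2
        = ‖c k - p‖ ^ 2 - 2 * inner ℝ (c k - p) (c l - p) + ‖c l - p‖ ^ 2 := by
      intro k l
      rw [← norm_sub_sq_real]
      congr 2
      ring
    simp only [h1, Finset.sum_add_distrib, Finset.sum_sub_distrib, ← Finset.mul_sum, ← inner_sum,
      hp0, inner_zero_right, Finset.sum_const, nsmul_eq_mul]
    rw [← hn]
    simp
    ring
  have hle : ∑ k ∈ s, ∑ l ∈ s, ‖c k - c l‖ ^ 2 ≤ n * (n - 1) := by
    rw [hn, ← nsmul_eq_mul]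
    refine Finset.sum_le_card_nsmul _ _ _ fun k hk => ?_
    rw [← Finset.add_sum_erase s _ hk, sub_self, norm_zero]
    have : ∑ l ∈ s.erase k, ‖c k - c l‖ ^ 2 ≤ #(s.erase k) • (1 : ℝ) :=
      Finset.sum_le_card_nsmul _ _ _ fun l hl =>
        pow_le_one₀ (norm_nonneg _) (hdiam k hk l (Finset.mem_of_mem_erase hl))
    rw [nsmul_eq_mul, Finset.cast_card_erase_of_mem hk] at this
    linarith
  have harea := sum_sub_normSq_mul_le s (fun k => c k - p) (A := n * m ^ 2 / 4) hm.le
    (by positivity) (by simpa using hsep)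
  simp only [Finset.sum_sub_distrib, Finset.sum_const, nsmul_eq_mul, ← hn] at harea
  have hV : ∑ k ∈ s, ‖c k - p‖ ^ 2 ≤ (n - 1) / 2 := by
    refine le_of_mul_le_mul_left ?_ (by linarith : 0 < 2 * n)
    linarith
  have hm2 : 0 < m ^ 2 := by positivity
  have h2 : n * (n * m ^ 2 / 4) - (∑ k ∈ s, ‖c k - p‖ ^ 2) - n * (m ^ 2 / 8)
      ≤ n ^ 2 * m ^ 2 / 8 := by
    refine le_of_mul_le_mul_right ?_ hm2
    linarith
  refine le_of_mul_le_mul_left ?_ (by linarith : 0 < n - 1)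
  linarith

/-- Interpolation of an exponential between its values at the exponents `0` and `1`. -/
lemma rpow_one_sub_le {τ x : ℝ} (hτ : 1 < τ) (hx : 1 ≤ x) :
    τ ^ (1 - max (τ - x) 0 / (τ - 1)) ≤ x := by
  have h0 : 0 < τ - 1 := by linarith
  rcases le_total τ x with h | h
  · rw [max_eq_right (by linarith)]
    simpa using h
  · rw [max_eq_left (by linarith)]
    have hθ : (τ - x) / (τ - 1) ≤ 1 := (div_le_one h0).2 (by linarith)
    have := Real.geom_mean_le_arith_mean2_weighted (w₁ := 1 - (τ - x) / (τ - 1))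
      (w₂ := (τ - x) / (τ - 1)) (p₁ := τ) (p₂ := 1) (by linarith)
      (div_nonneg (by linarith) h0.le) (by linarith) zero_le_one (by ring)
    rw [Real.one_rpow, mul_one] at this
    refine this.trans (le_of_eq ?_)
    field_simp
    ring

/-- Lower bound for the product of distances from one point to the others in a separated set. -/
lemma pow_two_mul_card_le {ι : Type*} (s : Finset ι) (z : ι → ℂ) (i : ι) (hi : i ∉ s)
    {μ τ : ℝ} (hμ : 0 < μ) (hτ : 1 < τ) (e : ℕ) (he : 4 * (τ - 1 / 8) ^ 2 ≤ e * (τ - 1))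
    (hsepi : ∀ k ∈ s, μ ≤ ‖z i - z k‖)
    (hsep : ∀ k ∈ s, ∀ l ∈ s, k ≠ l → μ ≤ ‖z k - z l‖) :
    τ ^ (2 * #s) ≤ τ ^ e * (∏ k ∈ s, ‖z i - z k‖ / μ) ^ 4 := by
  classical
  set x : ι → ℝ := fun k => (‖z i - z k‖ / μ) ^ 2 with hx
  have hxμ : ∀ k, ‖z k - z i‖ ^ 2 = x k * μ ^ 2 := by
    intro k
    rw [hx, norm_sub_rev]
    field_simp
  have h0 : 0 < τ - 1 := by linarith
  have hτ0 : 0 < τ := by linarith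
  set T := s.filter fun k => x k < τ with hT
  have hsum : ∑ k ∈ s, max (τ - x k) 0 ≤ 2 * (τ - 1 / 8) ^ 2 := by
    have h1 : ∑ k ∈ s, max (τ - x k) 0 = ∑ k ∈ T, (τ - x k) := by
      rw [hT, Finset.sum_filter]
      refine Finset.sum_congr rfl fun k _ => ?_
      split_ifs with h
      · exact max_eq_left (by linarith)
      · exact max_eq_right (by linarith)
    have hiT : i ∉ T := fun h => hi (Finset.mem_of_mem_filter i h)
    have hTs : ∀ k ∈ T, k ∈ s := fun k hk => Finset.mem_of_mem_filter k hk
    have h2 := sum_sub_normSq_mul_le (insert i T) (fun k => z k - z i) (A := μ ^ 2 * (τ + 1 / 8))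
      hμ.le (by positivity) (by
        intro k hk l hl hkl
        rw [sub_sub_sub_cancel_right]
        rcases Finset.mem_insert.1 hk with rfl | hk
        · rcases Finset.mem_insert.1 hl with rfl | hl
          · exact absurd rfl hkl
          · exact hsepi l (hTs l hl)
        · rcases Finset.mem_insert.1 hl with rfl | hl
          · rw [norm_sub_rev]; exact hsepi k (hTs k hk)
          · exact hsep k (hTs k hk) l (hTs l hl) hkl)
    rw [Finset.sum_insert hiT] at h2
    have h3 : ∑ k ∈ T, (μ ^ 2 * (τ + 1 / 8) - ‖z k - z i‖ ^ 2 - μ ^ 2 / 8)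
        = μ ^ 2 * ∑ k ∈ T, (τ - x k) := by
      rw [Finset.mul_sum]
      refine Finset.sum_congr rfl fun k _ => ?_
      rw [hxμ]
      ring
    rw [h3, sub_self, norm_zero] at h2
    rw [h1]
    refine le_of_mul_le_mul_left ?_ (by positivity : 0 < μ ^ 4)
    linarith
  have hprod : ∏ k ∈ s, τ ^ (1 - max (τ - x k) 0 / (τ - 1)) ≤ ∏ k ∈ s, x k :=
    Finset.prod_le_prod (fun k _ => by positivity) fun k hk => by
      refine rpow_one_sub_le hτ ?_
      exact one_le_pow₀ ((one_le_div hμ).2 (hsepi k hk))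
  rw [← Real.rpow_sum_of_pos hτ0, Finset.sum_sub_distrib, ← Finset.sum_div, Finset.sum_const,
    nsmul_eq_mul, mul_one, Finset.prod_pow] at hprod
  have hexp : (#s : ℝ) - e / 2 ≤ #s - (∑ k ∈ s, max (τ - x k) 0) / (τ - 1) := by
    have : (∑ k ∈ s, max (τ - x k) 0) / (τ - 1) ≤ e / 2 := by
      rw [div_le_iff₀ h0]
      linarith
    linarith
  have h1 := (Real.rpow_le_rpow_of_exponent_le hτ.le hexp).trans hprod
  have h2 := pow_le_pow_left₀ (Real.rpow_nonneg hτ0.le _) h1 2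
  rw [← Real.rpow_mul_natCast hτ0.le, ← pow_mul] at h2
  calc τ ^ (2 * #s) = τ ^ e * τ ^ (((#s : ℝ) - e / 2) * (2 : ℕ)) := by
        rw [← Real.rpow_natCast, ← Real.rpow_natCast, ← Real.rpow_add hτ0]
        congr 1
        push_cast
        ring
    _ ≤ _ := by gcongr

/-- Weighted arithmetic-geometric mean inequality for the product `(S - b) * b ^ k`. -/
lemma pow_mul_sub_mul_pow_le {S b : ℝ} (hS : 0 ≤ S) (hb : 0 ≤ b) {k : ℕ} (hk : 1 ≤ k) :
    ((k : ℝ) + 1) ^ (k + 1) * ((S - b) * b ^ k) ≤ (k : ℝ) ^ k * S ^ (k + 1) := by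
  have hk0 : (0 : ℝ) < k := by exact_mod_cast hk
  have h := maclaurin_tangent (N := (k : ℝ) + 1) (a := k * S) (b := (k + 1) * b)
    (by positivity) (by positivity) k le_rfl
  refine le_of_mul_le_mul_left ?_ hk0
  calc (k : ℝ) * (((k : ℝ) + 1) ^ (k + 1) * ((S - b) * b ^ k))
      = (k + 1) * (k * S) * ((k + 1) * b) ^ k - (k + 1 - 1) * ((k + 1) * b) ^ (k + 1) := by
        rw [mul_pow, mul_pow]
        ring
    _ ≤ _ := h
    _ = k * ((k : ℝ) ^ k * S ^ (k + 1)) := by ring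

/-- Numerator of the rational bound for the coefficient estimate of degree `N` and codegree `k`. -/
def profileNumer (N k : ℕ) : ℕ :=
  (N + 1).descFactorial (k + 1) * N * (100 * N + 89) ^ (k + 1) * k ^ k

/-- Denominator of the rational bound for the coefficient estimate of degree `N` and
codegree `k`. -/
def profileDenom (N k : ℕ) : ℕ :=
  (k + 1).factorial * (N + 1) ^ 2 * (N - 1) * (100 * N) ^ (k + 1) * (k + 1) ^ k

lemma profileDenom_pos {N k : ℕ} (hN : 2 ≤ N) : 0 < profileDenom N k := by
  have : 0 < N - 1 := by omega
  unfold profileDenom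
  positivity

lemma choose_mul_pow_mul_profileDenom_le {N k : ℕ} (hN : 2 ≤ N) (hk : 1 ≤ k) {x α : ℝ}
    (hα : 0 ≤ α) (hd : ((N : ℝ) - 1) * x - 1.78 ≤ 2 * (N * (1 - α))) :
    N.choose k * (x * α ^ k) * profileDenom N k ≤ 2 * (N + 1) * profileNumer N k := by
  have hN0 : (0 : ℝ) < N := by exact_mod_cast (by omega : 0 < N)
  set S : ℝ := (100 * N + 89) / (100 * N) with hS
  have hSN : 100 * N * S = 100 * N + 89 := by rw [hS]; field_simp
  have h1 := pow_mul_sub_mul_pow_le (S := S) (by positivity) hα hk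
  have h2 : ((N : ℝ) - 1) * x ≤ 2 * N * (S - α) := by linarith
  have h3 : ((N : ℝ) - 1) * x * α ^ k * (k + 1) ^ (k + 1) * (100 * N) ^ (k + 1)
      ≤ 2 * N * k ^ k * (100 * N + 89) ^ (k + 1) := by
    calc _ ≤ 2 * N * (S - α) * α ^ k * (k + 1) ^ (k + 1) * (100 * N) ^ (k + 1) := by gcongr
      _ = 2 * N * ((k + 1) ^ (k + 1) * ((S - α) * α ^ k)) * (100 * N) ^ (k + 1) := by ring
      _ ≤ 2 * N * (k ^ k * S ^ (k + 1)) * (100 * N) ^ (k + 1) := by gcongr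
      _ = 2 * N * k ^ k * (100 * N * S) ^ (k + 1) := by rw [mul_pow _ S]; ring
      _ = _ := by rw [hSN]
  have h4 : ((k + 1).factorial : ℝ) * N.choose k * (N + 1)
      = (k + 1) * (N + 1).descFactorial (k + 1) := by
    rw [Nat.descFactorial_eq_factorial_mul_choose]
    have := Nat.add_one_mul_choose_eq N k
    have : ((N : ℝ) + 1) * N.choose k = (N + 1).choose (k + 1) * (k + 1) := by exact_mod_cast this
    push_cast
    linear_combination ((k + 1).factorial : ℝ) * this
  have h5 : ((N - 1 : ℕ) : ℝ) = N - 1 := by rw [Nat.cast_sub (by omega)]; simp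
  unfold profileDenom profileNumer
  push_cast [h5]
  calc _ = (((k + 1).factorial : ℝ) * N.choose k * (N + 1))
        * ((N + 1) * (N - 1) * (x * α ^ k) * (100 * N) ^ (k + 1) * (k + 1) ^ k) := by ring
    _ = (N + 1).descFactorial (k + 1) * (N + 1)
        * (((N : ℝ) - 1) * x * α ^ k * (k + 1) ^ (k + 1) * (100 * N) ^ (k + 1)) := by
      rw [h4]; ring
    _ ≤ (N + 1).descFactorial (k + 1) * (N + 1)
        * (2 * N * k ^ k * (100 * N + 89) ^ (k + 1)) := by gcongr
    _ = _ := by ring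

lemma profileNumer_le_six : ∀ k < 7, 1 ≤ k →
    100 * profileNumer 6 k ≤ 71 * profileDenom 6 k := by
  decide +kernel

lemma profileNumer_le_seven : ∀ k < 8, 1 ≤ k → profileNumer 7 k ≤ profileDenom 7 k := by
  decide +kernel

lemma profileNumer_pow_le_of_lt_fourteen : ∀ N < 14, 8 ≤ N → ∀ k < N + 1, 1 ≤ k →
    profileNumer N k ^ 4 * (62 ^ 15 * 25 ^ (2 * N))
      ≤ profileDenom N k ^ 4 * (62 ^ (2 * N) * 25 ^ 15) := by
  decide +kernel

lemma profileNumer_pow_le_of_lt_fiftyNine : ∀ N < 59, 14 ≤ N → ∀ k < N + 1, 1 ≤ k →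
    profileNumer N k ^ 4 * (17 ^ 18 * 5 ^ (2 * N))
      ≤ profileDenom N k ^ 4 * (17 ^ (2 * N) * 5 ^ 18) := by
  decide +kernel

lemma le_mul_of_pow_four_le {P Q D : ℝ} {p q a b : ℕ} (hQ : 0 ≤ Q) (hD : 0 ≤ D) (hp : 0 < p)
    (hq : 0 < q) (h : P ^ 4 * (p ^ a * q ^ b) ≤ Q ^ 4 * (p ^ b * q ^ a))
    (hD4 : ((p : ℝ) / q) ^ b ≤ ((p : ℝ) / q) ^ a * D ^ 4) : P ≤ Q * D := by
  have hp0 : (0 : ℝ) < p := by exact_mod_cast hp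
  have hq0 : (0 : ℝ) < q := by exact_mod_cast hq
  refine le_of_pow_le_pow_left₀ (n := 4) (by norm_num) (by positivity) ?_
  refine le_of_mul_le_mul_right (h.trans ?_) (by positivity : (0 : ℝ) < p ^ a * q ^ b)
  have h1 : (p : ℝ) ^ b * q ^ a ≤ p ^ a * q ^ b * D ^ 4 := by
    rw [div_pow, div_pow, div_le_iff₀ (by positivity)] at hD4
    calc (p : ℝ) ^ b * q ^ a ≤ (p ^ a / q ^ a * D ^ 4 * q ^ b) * q ^ a := by gcongr
      _ = _ := by field_simp
  calc Q ^ 4 * (p ^ b * q ^ a) ≤ Q ^ 4 * (p ^ a * q ^ b * D ^ 4) := by gcongr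
    _ = _ := by ring

lemma profileNumer_le_of_fiftyNine_le {N k : ℕ} (hN : 59 ≤ N) (hk : 1 ≤ k) (hkN : k ≤ N) {D : ℝ}
    (hD : (2 : ℝ) ^ N ≤ 2 ^ 11 * D) : (profileNumer N k : ℝ) ≤ profileDenom N k * D := by
  have hNr : (59 : ℝ) ≤ N := by exact_mod_cast hN
  have hN0 : (0 : ℝ) < N := by linarith
  have hk0 : (0 : ℝ) < k := by exact_mod_cast hk
  set S : ℝ := (100 * N + 89) / (100 * N) with hS
  have hSN : 100 * N * S = 100 * N + 89 := by rw [hS]; field_simp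
  have hS0 : 0 ≤ S := by positivity
  have hpow : (1 + S) ^ (N + 1) ≤ 1.65 * 2 ^ (N + 1) := by
    have h1 : 1 + S = 2 * (0.445 / N + 1) := by rw [hS]; field_simp; ring
    have h2 : (0.445 / N + 1) ^ (N + 1) ≤ Real.exp (1 / 2) := by
      calc (0.445 / N + 1 : ℝ) ^ (N + 1) ≤ Real.exp (0.445 / N) ^ (N + 1) := by
            gcongr
            exact Real.add_one_le_exp _
        _ = Real.exp ((N + 1 : ℕ) * (0.445 / N)) := (Real.exp_nat_mul _ _).symm
        _ ≤ _ := by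
            rw [Real.exp_le_exp, ← mul_div_assoc, div_le_iff₀ hN0]
            push_cast
            linarith
    have h3 : Real.exp (1 / 2) ≤ 1.65 := by
      refine le_of_pow_le_pow_left₀ (n := 2) (by norm_num) (by norm_num) ?_
      rw [← Real.exp_nat_mul]
      norm_num
      linarith [Real.exp_one_lt_d9]
    rw [h1, mul_pow]
    nlinarith [h2.trans h3, pow_pos (zero_lt_two' ℝ) (N + 1)]
  have hch : (N + 1).choose (k + 1) * S ^ (k + 1) ≤ (1 + S) ^ (N + 1) := by
    rw [add_comm 1 S, add_pow]
    have := Finset.single_le_sum (f := fun m => S ^ m * 1 ^ (N + 1 - m) * ((N + 1).choose m : ℝ))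
      (s := Finset.range (N + 1 + 1)) (fun m _ => by positivity) (a := k + 1)
      (Finset.mem_range.2 (by omega))
    refine le_trans (le_of_eq ?_) this
    simp [mul_comm]
  have hkk : 2 * (k : ℝ) ^ k ≤ (k + 1) ^ k := by
    have h1 := one_add_mul_le_pow (a := 1 / (k : ℝ)) 
      ((by norm_num : (-2 : ℝ) ≤ 0).trans (by positivity)) k
    have h2 : 1 + (k : ℝ) * (1 / k) = 2 := by field_simp; norm_num
    have h3 : ((k : ℝ) + 1) ^ k = (1 + 1 / k) ^ k * k ^ k := by
      rw [← mul_pow]; congr 1; field_simp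
    rw [h3]
    rw [h2] at h1
    gcongr
  have h5 : ((N - 1 : ℕ) : ℝ) = N - 1 := by rw [Nat.cast_sub (by omega)]; simp
  have hmain : N * (2 ^ (N + 1) * 1.65) ≤ 2 * ((N + 1) ^ 2 * (N - 1) * D) := by
    have h6 : N * 3379.2 ≤ ((N : ℝ) + 1) ^ 2 * (N - 1) := by nlinarith
    have hD0 : 0 ≤ D := by
      have := pow_pos (zero_lt_two' ℝ) N
      linarith
    calc N * (2 ^ (N + 1) * 1.65) = N * 3.3 * (2 : ℝ) ^ N := by ring
      _ ≤ N * 3.3 * (2 ^ 11 * D) := by gcongr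
      _ = 2 * (N * 3379.2 * D) := by ring
      _ ≤ _ := by gcongr
  unfold profileDenom profileNumer
  rw [Nat.descFactorial_eq_factorial_mul_choose]
  push_cast [h5]
  rw [← hSN, mul_pow _ S]
  calc _ = ((k + 1).factorial : ℝ) * (100 * N) ^ (k + 1) * N * k ^ k
        * ((N + 1).choose (k + 1) * S ^ (k + 1)) := by ring
    _ ≤ ((k + 1).factorial : ℝ) * (100 * N) ^ (k + 1) * N * k ^ k * (1.65 * 2 ^ (N + 1)) := by
      exact mul_le_mul_of_nonneg_left (hch.trans hpow) (by positivity)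
    _ = ((k + 1).factorial : ℝ) * (100 * N) ^ (k + 1) * k ^ k * (N * (2 ^ (N + 1) * 1.65)) := by
      ring
    _ ≤ ((k + 1).factorial : ℝ) * (100 * N) ^ (k + 1) * k ^ k
        * (2 * ((N + 1) ^ 2 * (N - 1) * D)) := by gcongr
    _ = ((k + 1).factorial : ℝ) * (100 * N) ^ (k + 1)  * ((N + 1) ^ 2 * (N - 1) * D)
        * (2 * k ^ k) := by ring
    _ ≤ ((k + 1).factorial : ℝ) * (100 * N) ^ (k + 1) * ((N + 1) ^ 2 * (N - 1) * D)
        * (k + 1) ^ k := by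
      have : 0 ≤ (N + 1) ^ 2 * ((N : ℝ) - 1) * D := by
        have : (0 : ℝ) ≤ N * (2 ^ (N + 1) * 1.65) := by positivity
        linarith
      gcongr
    _ = _ := by ring

/-- The numerical core: the Maclaurin bound for a coefficient, optimised over the mean modulus,
is compensated by the product of the normalised distances. -/
lemma choose_mul_pow_mul_le {N k : ℕ} (hN : 1 ≤ N) (hkN : k ≤ N) {μ α D : ℝ} (hα0 : 0 ≤ α)
    (hα1 : α ≤ 1) (hμ0 : 0 < μ) (hμ1 : μ ≤ 1) (hD1 : 1 ≤ D)
    (hd : ∀ x, 0 ≤ x → x ≤ μ → x ≤ 0.71 → ((N : ℝ) - 1) * x - 1.78 ≤ 2 * (N * (1 - α)))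
    (harea : ((N : ℝ) + 1) * μ ^ 2 ≤ 4)
    (hpack : ∀ τ : ℝ, 1 < τ → ∀ e : ℕ, 4 * (τ - 1 / 8) ^ 2 ≤ e * (τ - 1) →
      τ ^ (2 * N) ≤ τ ^ e * D ^ 4) :
    N.choose k * (μ * α ^ k) ≤ 2 * (N + 1) * D := by
  have hμα : μ * α ^ k ≤ 1 := mul_le_one₀ hμ1 (by positivity) (pow_le_one₀ hα0 hα1)
  have htriv : ((N.choose k : ℕ) : ℝ) ≤ 2 * (N + 1) →
      N.choose k * (μ * α ^ k) ≤ 2 * (N + 1) * D := by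
    intro h
    calc N.choose k * (μ * α ^ k) ≤ N.choose k * 1 := by gcongr
      _ ≤ 2 * (N + 1) * 1 := by linarith
      _ ≤ _ := by gcongr
  rcases Nat.eq_zero_or_pos k with rfl | hk
  · refine htriv ?_
    simp
    linarith [(Nat.cast_nonneg N : (0 : ℝ) ≤ N)]
  rcases Nat.lt_or_ge N 6 with h6 | h6
  · refine htriv ?_
    have : ∀ N < 6, ∀ k ≤ N, N.choose k ≤ 2 * (N + 1) := by decide
    exact_mod_cast this N h6 k hkN
  have hN2 : 2 ≤ N := by omega
  have hQ : (0 : ℝ) < profileDenom N k := by exact_mod_cast profileDenom_pos hN2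
  rcases Nat.eq_or_lt_of_le h6 with rfl | h7
  · have h := choose_mul_pow_mul_profileDenom_le (x := 0.71 * μ) hN2 hk hα0
      (hd _ (by positivity) (by linarith) (by linarith))
    have hP : (100 * profileNumer 6 k : ℝ) ≤ 71 * profileDenom 6 k := by
      exact_mod_cast profileNumer_le_six k (by omega) hk
    refine le_trans ?_ (le_mul_of_one_le_right (by positivity) hD1)
    refine le_of_mul_le_mul_right ?_ hQ
    rw [Nat.cast_ofNat] at h ⊢
    linarith
  have h8 : (8 : ℝ) ≤ N + 1 := by exact_mod_cast (by omega : 8 ≤ N + 1)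
  have hμ : μ ≤ 0.71 := by
    by_contra! h
    nlinarith
  have h := choose_mul_pow_mul_profileDenom_le hN2 hk hα0 (hd μ hμ0.le le_rfl hμ)
  suffices hP : (profileNumer N k : ℝ) ≤ profileDenom N k * D by
    refine le_of_mul_le_mul_right ?_ hQ
    refine h.trans ?_
    calc (2 * (N + 1) * profileNumer N k : ℝ) ≤ 2 * (N + 1) * (profileDenom N k * D) := by gcongr
      _ = _ := by ring
  rcases Nat.lt_or_ge N 8 with h8 | h8
  · obtain rfl : N = 7 := by omega
    refine le_trans ?_ (le_mul_of_one_le_right hQ.le hD1)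
    exact_mod_cast profileNumer_le_seven k (by omega) hk
  rcases Nat.lt_or_ge N 14 with h14 | h14
  · refine le_mul_of_pow_four_le (p := 62) (q := 25) (a := 15) (b := 2 * N) hQ.le
      (by linarith) (by norm_num) (by norm_num) ?_
      (hpack _ (by norm_num) 15 (by norm_num))
    exact_mod_cast profileNumer_pow_le_of_lt_fourteen N h14 h8 k (by omega) hk
  rcases Nat.lt_or_ge N 59 with h59 | h59
  · refine le_mul_of_pow_four_le (p := 17) (q := 5) (a := 18) (b := 2 * N) hQ.le
      (by linarith) (by norm_num) (by norm_num) ?_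
      (hpack _ (by norm_num) 18 (by norm_num))
    exact_mod_cast profileNumer_pow_le_of_lt_fiftyNine N h59 h14 k (by omega) hk
  · refine profileNumer_le_of_fiftyNine_le h59 hk hkN ?_
    refine le_of_pow_le_pow_left₀ (n := 4) (by norm_num) (by positivity) ?_
    have := hpack 4 (by norm_num) 22 (by norm_num)
    calc ((2 : ℝ) ^ N) ^ 4 = 4 ^ (2 * N) := by
          rw [show (4 : ℝ) = 2 ^ 2 by norm_num, ← pow_mul, ← pow_mul]
          congr 1
          omega
      _ ≤ _ := this
      _ = _ := by rw [mul_pow]; norm_num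

/-- The coefficient bound for separated points of the unit disc, in normalised form. -/
lemma choose_mul_mean_pow_le_prod {ι : Type*} (s : Finset ι) (hs : s.Nonempty) (z : ι → ℂ)
    {i : ι} (hi : i ∉ s) {μ : ℝ} (hμ0 : 0 < μ) (hμ1 : μ ≤ 1) (hz : ∀ k, ‖z k‖ ≤ 1)
    (hdiam : ∀ k l, ‖z k - z l‖ ≤ 1) (hsep : ∀ k l, k ≠ l → μ ≤ ‖z k - z l‖) {k : ℕ}
    (hk : k ≤ #s) :
    (#s).choose k * (μ * ((∑ l ∈ s, ‖z l‖) / #s) ^ k)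
      ≤ 2 * (#s + 1) * ∏ l ∈ s, ‖z i - z l‖ / μ := by
  classical
  have hs0 : (0 : ℝ) < #s := by exact_mod_cast hs.card_pos
  have hsepi : ∀ l ∈ s, μ ≤ ‖z i - z l‖ := fun l hl => hsep i l (by rintro rfl; exact hi hl)
  refine choose_mul_pow_mul_le hs.card_pos hk (by positivity) ?_ hμ0 hμ1 ?_ ?_ ?_ ?_
  · rw [div_le_one hs0]
    calc ∑ l ∈ s, ‖z l‖ ≤ #s • (1 : ℝ) := Finset.sum_le_card_nsmul _ _ _ fun l _ => hz l
      _ = #s := by simp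
  · rw [← Finset.prod_const_one (s := s)]
    exact Finset.prod_le_prod (fun _ _ => zero_le_one) fun l hl => (one_le_div hμ0).2 (hsepi l hl)
  · intro x hx0 hxμ hx
    have h := card_sub_one_mul_le_sum_depth s z hx0 hx (fun k _ => hz k)
      (fun k _ l _ => hdiam k l) (fun k _ l _ hkl => hxμ.trans (hsep k l hkl))
    rw [Finset.sum_sub_distrib, Finset.sum_const, nsmul_eq_mul, mul_one] at h
    rwa [mul_sub (#s : ℝ), mul_div_cancel₀ _ hs0.ne', mul_one]
  · have h := card_mul_sq_le_four (insert i s) z hμ0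
      (by rw [Finset.card_insert_of_notMem hi]; have := hs.card_pos; omega)
      (fun k _ l _ => hdiam k l) (fun k _ l _ hkl => hsep k l hkl)
    rw [Finset.card_insert_of_notMem hi] at h
    exact_mod_cast h
  · intro τ hτ e he
    exact pow_two_mul_card_le s z i hi hμ0 hτ e he hsepi fun k _ l _ hkl => hsep k l hkl

open Polynomial in
/-- The entries of the inverse Vandermonde matrix are coefficients of Lagrange polynomials. -/
lemma inv_vandermonde_apply {n : ℕ} {r : Fin n → ℂ} (hr : Function.Injective r)
    {V : Matrix (Fin n) (Fin n) ℂ} (hV : ∀ i j, V i j = r j ^ (i : ℕ)) (i j : Fin n) :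
    V⁻¹ i j = (∏ k ∈ univ.erase i, (r i - r k))⁻¹
      * (∏ k ∈ univ.erase i, (X - C (r k))).coeff j := by
  have hinv : V⁻¹ = Matrix.of fun i j : Fin n => (Lagrange.basis univ r i).coeff j := by
    refine Matrix.inv_eq_left_inv ?_
    ext a l
    have hdeg : (Lagrange.basis univ r a).natDegree < n := by
      rw [Lagrange.natDegree_basis hr.injOn (mem_univ a)]
      have := a.2
      simp
      omega
    rw [Matrix.mul_apply, Matrix.one_apply]
    simp only [Matrix.of_apply, hV]
    rw [Fin.sum_univ_eq_sum_range (fun b => (Lagrange.basis univ r a).coeff b * r l ^ b),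
      ← eval_eq_sum_range' hdeg]
    split_ifs with h
    · rw [h, Lagrange.eval_basis_self hr.injOn (mem_univ l)]
    · exact Lagrange.eval_basis_of_ne h (mem_univ l)
  rw [hinv, Matrix.of_apply, Lagrange.basis]
  simp only [Lagrange.basisDivisor]
  rw [Finset.prod_mul_distrib, ← map_prod, coeff_C_mul, Finset.prod_inv_distrib]

/-- The inverse Vandermonde bound in terms of arbitrary bounds for the moduli, the diameter and
the separation. -/
lemma norm_inv_vandermonde_le {n : ℕ} (hn : 2 ≤ n) {r : Fin n → ℂ} {M m R : ℝ} (hM1 : 1 ≤ M)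
    (hR1 : 1 ≤ R) (hm0 : 0 < m) (hm1 : m ≤ 1) (hR : ∀ i, ‖r i‖ ≤ R)
    (hM : ∀ i j, ‖r i - r j‖ ≤ M) (hm : ∀ i j, i ≠ j → m ≤ ‖r i - r j‖)
    {V : Matrix (Fin n) (Fin n) ℂ} (hV : ∀ i j, V i j = r j ^ (i : ℕ)) (i j : Fin n) :
    ‖V⁻¹ i j‖ ≤ 2 * n * (R * M / m) ^ n := by
  have hr : Function.Injective r := by
    intro a b hab
    by_contra h
    have := hm a b h
    rw [hab, sub_self, norm_zero] at this
    linarith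
  set K := R * M with hK
  have hK1 : 1 ≤ K := one_le_mul_of_one_le_of_one_le hR1 hM1
  have hK0 : 0 < K := by linarith
  have hRK : R ≤ K := le_mul_of_one_le_right (by linarith) hM1
  have hMK : M ≤ K := le_mul_of_one_le_left (by linarith) hR1
  set s := univ.erase i with hs
  have hcard : #s + 1 = n := by
    rw [hs, Finset.card_erase_of_mem (mem_univ i)]
    simp
    omega
  have hcard' : (#s : ℝ) + 1 = n := by exact_mod_cast hcard
  have hne : s.Nonempty := Finset.card_pos.1 (by omega)
  have hi : i ∉ s := Finset.notMem_erase i _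
  have hnorm : ∀ w : ℂ, ‖w / (K : ℂ)‖ = ‖w‖ / K := by
    intro w
    rw [norm_div, Complex.norm_real, Real.norm_of_nonneg hK0.le]
  have hj : (j : ℕ) ≤ #s := by omega
  set k := #s - j with hk
  have hcore := choose_mul_mean_pow_le_prod s hne (fun l => r l / (K : ℂ)) hi (μ := m / K)
    (by positivity) ((div_le_one hK0).2 (by linarith))
    (fun l => by rw [hnorm, div_le_one hK0]; exact (hR l).trans hRK)
    (fun a b => by rw [← sub_div, hnorm, div_le_one hK0]; exact (hM a b).trans hMK)
    (fun a b hab => by rw [← sub_div, hnorm]; gcongr; exact hm a b hab) (k := k) (Nat.sub_le _ _)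
  simp only [hnorm, ← sub_div, div_div_div_cancel_right₀ hK0.ne'] at hcore
  rw [← Finset.sum_div, Finset.prod_div_distrib, Finset.prod_const, hcard', hk,
    Nat.choose_symm hj, ← hk] at hcore
  set P := ∏ l ∈ s, ‖r i - r l‖ with hP
  have hP0 : 0 < P := Finset.prod_pos fun l hl => norm_pos_iff.2
    (sub_ne_zero.2 (hr.ne (Finset.ne_of_mem_erase hl).symm))
  have hcoeff := (norm_coeff_prod_X_sub_C_le s r j).trans
    (coeff_prod_X_add_C_le #s s (fun l => ‖r l‖) rfl (fun _ _ => norm_nonneg _) j hj)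
  rw [← hk] at hcoeff
  rw [inv_vandermonde_apply hr hV, norm_mul, norm_inv, norm_prod, ← hs, ← hP, inv_mul_le_iff₀ hP0]
  refine hcoeff.trans ?_
  set β := (∑ l ∈ s, ‖r l‖) / #s with hβ
  have hβ0 : 0 ≤ β := by positivity
  rw [show (∑ l ∈ s, ‖r l‖) / K / #s = β / K by rw [hβ]; ring] at hcore
  clear_value β
  have hpow : β ^ k ≤ K ^ #s * (β / K) ^ k := by
    calc β ^ k = K ^ k * (β / K) ^ k := by rw [div_pow]; field_simp
      _ ≤ _ := by
        have : k ≤ #s := Nat.sub_le _ _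
        gcongr
  have hsucc : ∀ x : ℝ, x ^ n = x ^ #s * x := fun x => by rw [← pow_succ, hcard]
  calc ((#s).choose j : ℝ) * β ^ k ≤ (#s).choose j * (K ^ #s * (β / K) ^ k) := by gcongr
    _ = K ^ n / m * ((#s).choose j * (m / K * (β / K) ^ k)) := by
      rw [hsucc]
      field_simp
    _ ≤ K ^ n / m * (2 * n * (P / m ^ #s)) := by gcongr
    _ = _ := by
      rw [div_pow, hsucc m]
      field_simp

/-- Second bound of Theorem 3: the entries of the inverse of the Vandermonde
matrix of pairwise distinct points are bounded by `2n (RM/m)^n`. -/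
theorem inverse_vandermonde_entry_bound (n : ℕ) (hn : 2 ≤ n)
    (r : Fin n → ℂ) (hr : Function.Injective r)
    (M m R : ℝ)
    (hM : M = max (sSup {d : ℝ | ∃ i j : Fin n, d = ‖r i - r j‖}) 1)
    (hm : m = min (sInf {d : ℝ | ∃ i j : Fin n, i ≠ j ∧ d = ‖r i - r j‖}) 1)
    (hR : R = max (sSup {d : ℝ | ∃ i : Fin n, d = ‖r i‖}) 1)
    (V : Matrix (Fin n) (Fin n) ℂ)
    (hV : ∀ i j : Fin n, V i j = r j ^ (i : ℕ)) :
    ∀ i j : Fin n, ‖V⁻¹ i j‖ ≤ 2 * n * (R * M / m) ^ n := by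
  have hMfin : {d : ℝ | ∃ i j : Fin n, d = ‖r i - r j‖}.Finite :=
    (Set.finite_range fun p : Fin n × Fin n => ‖r p.1 - r p.2‖).subset
      (by rintro _ ⟨i, j, rfl⟩; exact ⟨(i, j), rfl⟩)
  have hmfin : {d : ℝ | ∃ i j : Fin n, i ≠ j ∧ d = ‖r i - r j‖}.Finite :=
    hMfin.subset (by rintro _ ⟨i, j, _, rfl⟩; exact ⟨i, j, rfl⟩)
  have hRfin : {d : ℝ | ∃ i : Fin n, d = ‖r i‖}.Finite :=
    (Set.finite_range fun i => ‖r i‖).subset (by rintro _ ⟨i, rfl⟩; exact ⟨i, rfl⟩)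
  have hmne : {d : ℝ | ∃ i j : Fin n, i ≠ j ∧ d = ‖r i - r j‖}.Nonempty :=
    ⟨_, ⟨0, by omega⟩, ⟨1, by omega⟩, by simp, rfl⟩
  have hm0 : 0 < m := by
    obtain ⟨i, j, hij, h⟩ := hmne.csInf_mem hmfin
    rw [hm, h]
    exact lt_min (norm_pos_iff.2 (sub_ne_zero.2 (hr.ne hij))) one_pos
  refine norm_inv_vandermonde_le hn (hM ▸ le_max_right _ _) (hR ▸ le_max_right _ _) hm0
    (hm ▸ min_le_right _ _) (fun i => ?_) (fun i j => ?_) (fun i j hij => ?_) hV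
  · rw [hR]
    exact (le_csSup hRfin.bddAbove ⟨i, rfl⟩).trans (le_max_left _ _)
  · rw [hM]
    exact (le_csSup hMfin.bddAbove ⟨i, j, rfl⟩).trans (le_max_left _ _)
  · rw [hm]
    exact (min_le_left _ _).trans (csInf_le hmfin.bddBelow ⟨i, j, hij, rfl⟩)
end

section
/- Let n >= 2 and let r_1, ..., r_n be pairwise distinct nonzero complex numbers. Set M = max(max_{i,j} |r_i - r_j|, 1), m = min(min_{i != j} |r_i - r_j|, 1), R = max(max_i |r_i|, 1), and r = min(min_i |r_i|, 1). Let V_0 be the n-by-n matrix with (i,j) entry r_j^i for 1 <= i, j <= n. Then every entry of the inverse satisfies |(V_0^{-1})_{i,j}| <= (2n/r) * (R*M/m)^n. (Magnitude bound of the Corollary to Theorem 3.) -/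
open Finset Matrix

/-- Half-width of the arc reserved, as seen from the origin, for a point of modulus `a`. -/
noncomputable def arcHalfWidth (a : ℝ) : ℝ :=
  Real.pi / 6 - Real.pi / (3 * Real.log 3) * Real.log a

lemma log_three_pos : 0 < Real.log 3 := Real.log_pos (by norm_num)

lemma concaveOn_cos_comp_affine :
    ConcaveOn ℝ (Set.Icc 0 (Real.log 3))
      (fun v => Real.cos (Real.pi / 3 - Real.pi / (3 * Real.log 3) * v)) := by
  have hl := log_three_pos
  have hpi := Real.pi_pos
  have key : ∀ v ∈ Set.Icc 0 (Real.log 3),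
      Real.pi / 3 - Real.pi / (3 * Real.log 3) * v ∈ Set.Icc (-(Real.pi / 2)) (Real.pi / 2) := by
    rintro v ⟨h0, h1⟩
    have h2 : Real.pi / (3 * Real.log 3) * v ≤ Real.pi / (3 * Real.log 3) * Real.log 3 := by gcongr
    have h3 : Real.pi / (3 * Real.log 3) * Real.log 3 = Real.pi / 3 := by field_simp
    have h4 : 0 ≤ Real.pi / (3 * Real.log 3) * v := by positivity
    constructor <;> linarith
  refine ⟨convex_Icc _ _, fun x hx y hy a b ha hb hab => ?_⟩
  have h := strictConcaveOn_cos_Icc.concaveOn.2 (key x hx) (key y hy) ha hb hab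
  convert h using 2
  simp only [smul_eq_mul]
  linear_combination (-Real.pi / 3) * hab

lemma nonneg_of_concaveOn_Icc {f : ℝ → ℝ} {a b : ℝ} (hf : ConcaveOn ℝ (Set.Icc a b) f)
    (ha : 0 ≤ f a) (hb : 0 ≤ f b) {x : ℝ} (hx : x ∈ Set.Icc a b) : 0 ≤ f x := by
  have hab := hx.1.trans hx.2
  exact (le_min ha hb).trans (hf.min_le_of_mem_Icc (Set.left_mem_Icc.2 hab)
    (Set.right_mem_Icc.2 hab) hx)

lemma exp_half_log_three : Real.exp (Real.log 3 / 2) = √3 := by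
  rw [← Real.log_sqrt (by norm_num), Real.exp_log (by positivity)]

lemma cos_at_half_log_three :
    Real.cos (Real.pi / 3 - Real.pi / (3 * Real.log 3) * (Real.log 3 / 2)) = √3 / 2 := by
  have hl := log_three_pos
  rw [← Real.cos_pi_div_six]
  congr 1
  field_simp
  norm_num

lemma exp_le_two_mul_cos {v : ℝ} (hv : v ∈ Set.Icc 0 (Real.log 3 / 2)) :
    Real.exp v ≤ 2 * Real.cos (Real.pi / 3 - Real.pi / (3 * Real.log 3) * v) := by
  have hl := log_three_pos
  have hc : ConcaveOn ℝ (Set.Icc 0 (Real.log 3 / 2))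
      (fun v => (2 : ℝ) • Real.cos (Real.pi / 3 - Real.pi / (3 * Real.log 3) * v)
        - Real.exp v) :=
    ((concaveOn_cos_comp_affine.subset (Set.Icc_subset_Icc_right (by linarith))
      (convex_Icc _ _)).smul (by norm_num)).sub (convexOn_exp.subset (Set.subset_univ _)
        (convex_Icc _ _))
  have := nonneg_of_concaveOn_Icc hc (by simp) (by
    simp only [cos_at_half_log_three, exp_half_log_three, smul_eq_mul]; linarith) hv
  simp only [smul_eq_mul] at this
  linarith

lemma exp_add_exp_neg_le_two_mul_cos {v : ℝ} (hv : v ∈ Set.Icc (Real.log 3 / 2) (Real.log 3)) :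
    Real.exp v / 3 + 2 * Real.exp (-v) ≤
      2 * Real.cos (Real.pi / 3 - Real.pi / (3 * Real.log 3) * v) := by
  have hl := log_three_pos
  have h3 : √3 * √3 = 3 := Real.mul_self_sqrt (by norm_num)
  have h3' : 0 < √3 := by positivity
  have hneg : ConvexOn ℝ Set.univ (fun v : ℝ => Real.exp (-v)) := by
    refine ⟨convex_univ, fun x _ y _ a b ha hb hab => ?_⟩
    convert convexOn_exp.2 (Set.mem_univ (-x)) (Set.mem_univ (-y)) ha hb hab using 2
    simp only [smul_eq_mul]; ring
  have hc : ConcaveOn ℝ (Set.Icc (Real.log 3 / 2) (Real.log 3))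
      (fun v => (2 : ℝ) • Real.cos (Real.pi / 3 - Real.pi / (3 * Real.log 3) * v)
        - ((1 / 3 : ℝ) • Real.exp v + (2 : ℝ) • Real.exp (-v))) :=
    ((concaveOn_cos_comp_affine.subset (Set.Icc_subset_Icc_left (by linarith))
      (convex_Icc _ _)).smul (by norm_num)).sub
      (((convexOn_exp.smul (by norm_num)).add (hneg.smul (by norm_num))).subset
        (Set.subset_univ _) (convex_Icc _ _))
  have := nonneg_of_concaveOn_Icc hc (by
    simp only [cos_at_half_log_three, Real.exp_neg, exp_half_log_three, smul_eq_mul]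
    have : (√3)⁻¹ = √3 / 3 := by field_simp; nlinarith
    rw [this]; linarith) (by
    have : Real.pi / 3 - Real.pi / (3 * Real.log 3) * Real.log 3 = 0 := by field_simp; ring
    simp only [this, Real.cos_zero, Real.exp_neg, Real.exp_log (show (0 : ℝ) < 3 by norm_num),
      smul_eq_mul]
    norm_num) hv
  simp only [smul_eq_mul] at this
  linarith

lemma sq_add_sq_sub_one_le {a b : ℝ} (ha : 1 ≤ a) (hb : 1 ≤ b) (ha3 : a ^ 2 ≤ 3)
    (hb3 : b ^ 2 ≤ 3) :
    a ^ 2 + b ^ 2 - 1 ≤ 2 * a * b * Real.cos (arcHalfWidth a + arcHalfWidth b) := by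
  have hu : 1 ≤ a * b := one_le_mul_of_one_le_of_one_le ha hb
  have hu0 : 0 < a * b := by linarith
  have hu3 : a * b ≤ 3 := by nlinarith [sq_nonneg (a - b)]
  have hw : arcHalfWidth a + arcHalfWidth b =
      Real.pi / 3 - Real.pi / (3 * Real.log 3) * Real.log (a * b) := by
    rw [Real.log_mul (by positivity) (by positivity)]; unfold arcHalfWidth; ring
  rw [hw]
  have hv0 : 0 ≤ Real.log (a * b) := Real.log_nonneg hu
  have hv1 : Real.log (a * b) ≤ Real.log 3 := Real.log_le_log hu0 hu3
  rcases le_total (Real.log (a * b)) (Real.log 3 / 2) with h | h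
  · have := exp_le_two_mul_cos ⟨hv0, h⟩
    rw [Real.exp_log hu0] at this
    have h2 := mul_le_mul_of_nonneg_left this hu0.le
    nlinarith [mul_nonneg (show 0 ≤ a ^ 2 - 1 by nlinarith) (show 0 ≤ b ^ 2 - 1 by nlinarith)]
  · have := exp_add_exp_neg_le_two_mul_cos ⟨h, hv1⟩
    rw [Real.exp_neg, Real.exp_log hu0] at this
    have h2 := mul_le_mul_of_nonneg_left this hu0.le
    have h3 : a * b * (a * b / 3 + 2 * (a * b)⁻¹) = (a * b) ^ 2 / 3 + 2 := by field_simp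
    rw [h3] at h2
    nlinarith [mul_nonneg (sub_nonneg.2 ha3) (sub_nonneg.2 hb3)]

lemma arcHalfWidth_le {a : ℝ} (ha : 1 ≤ a) : arcHalfWidth a ≤ Real.pi / 6 := by
  have := log_three_pos
  have := Real.log_nonneg ha
  have : 0 ≤ Real.pi / (3 * Real.log 3) * Real.log a := by positivity
  unfold arcHalfWidth
  linarith

lemma arcHalfWidth_eq_mul (a : ℝ) :
    arcHalfWidth a = Real.pi / (6 * Real.log 3) * (Real.log 3 - Real.log (a ^ 2)) := by
  have := log_three_pos
  rw [arcHalfWidth, Real.log_pow]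
  field_simp
  push_cast
  ring

lemma arcHalfWidth_nonneg {a : ℝ} (ha : 1 ≤ a) (ha3 : a ^ 2 ≤ 3) : 0 ≤ arcHalfWidth a := by
  have := log_three_pos
  have h := Real.log_le_log (by positivity) ha3
  rw [arcHalfWidth_eq_mul]
  exact mul_nonneg (by positivity) (sub_nonneg.2 h)

lemma norm_sub_sq_eq_cos_arg (p q : ℂ) :
    ‖p - q‖ ^ 2 = ‖p‖ ^ 2 + ‖q‖ ^ 2 - 2 * ‖p‖ * ‖q‖ * Real.cos (p.arg - q.arg) := by
  rw [Real.cos_sub]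
  have h1 := Complex.norm_mul_cos_arg p
  have h2 := Complex.norm_mul_sin_arg p
  have h3 := Complex.norm_mul_cos_arg q
  have h4 := Complex.norm_mul_sin_arg q
  have e : 2 * ‖p‖ * ‖q‖ * (Real.cos p.arg * Real.cos q.arg + Real.sin p.arg * Real.sin q.arg)
      = 2 * (p.re * q.re + p.im * q.im) := by
    rw [← h1, ← h2, ← h3, ← h4]; ring
  rw [e, Complex.sq_norm, Complex.sq_norm, Complex.sq_norm]
  simp only [Complex.normSq_apply, Complex.sub_re, Complex.sub_im]
  ring

lemma arcHalfWidth_add_le_norm_arg_sub {p q : ℂ} (hp : 1 ≤ ‖p‖) (hq : 1 ≤ ‖q‖)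
    (hp3 : ‖p‖ ^ 2 ≤ 3) (hq3 : ‖q‖ ^ 2 ≤ 3) (hpq : 1 ≤ ‖p - q‖) :
    arcHalfWidth ‖p‖ + arcHalfWidth ‖q‖ ≤
      ‖((p.arg - q.arg : ℝ) : AddCircle (2 * Real.pi))‖ := by
  by_contra! hlt
  have hcos : Real.cos ‖((p.arg - q.arg : ℝ) : AddCircle (2 * Real.pi))‖ =
      Real.cos (p.arg - q.arg) := by
    rw [AddCircle.norm_eq, Real.cos_abs, Real.cos_sub_int_mul_two_pi]
  have hle := arcHalfWidth_le hp
  have hle' := arcHalfWidth_le hq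
  have h := Real.cos_lt_cos_of_nonneg_of_le_pi (norm_nonneg _)
    (by linarith [Real.pi_pos]) hlt
  rw [hcos] at h
  have h1 := sq_add_sq_sub_one_le hp hq hp3 hq3
  have h2 := norm_sub_sq_eq_cos_arg p q
  have h3 : 0 < 2 * ‖p‖ * ‖q‖ := by positivity
  have h4 := mul_lt_mul_of_pos_left h h3
  nlinarith

lemma sum_arcHalfWidth_le (S : Finset ℂ) (h1 : ∀ p ∈ S, 1 ≤ ‖p‖) (h3 : ∀ p ∈ S, ‖p‖ ^ 2 ≤ 3)
    (hS : ∀ p ∈ S, ∀ q ∈ S, p ≠ q → 1 ≤ ‖p - q‖) :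
    ∑ p ∈ S, arcHalfWidth ‖p‖ ≤ Real.pi := by
  have : Fact (0 < 2 * Real.pi) := ⟨Real.two_pi_pos⟩
  have hdisj : Set.PairwiseDisjoint (S : Set ℂ)
      (fun p : ℂ => Metric.ball (p.arg : AddCircle (2 * Real.pi)) (arcHalfWidth ‖p‖)) := by
    intro p hp q hq hpq
    apply Metric.ball_disjoint_ball
    rw [dist_eq_norm, ← AddCircle.coe_sub]
    exact arcHalfWidth_add_le_norm_arg_sub (h1 p hp) (h1 q hq) (h3 p hp) (h3 q hq)
      (hS p hp q hq hpq)
  have hm := MeasureTheory.sum_measure_le_measure_univ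
    (μ := (MeasureTheory.volume : MeasureTheory.Measure (AddCircle (2 * Real.pi))))
    (s := S) (fun p _ => Metric.isOpen_ball.measurableSet.nullMeasurableSet)
    (fun p hp q hq hpq => (hdisj hp hq hpq).aedisjoint)
  have hv : ∀ p ∈ S, MeasureTheory.volume
      (Metric.ball (p.arg : AddCircle (2 * Real.pi)) (arcHalfWidth ‖p‖)) =
        ENNReal.ofReal (2 * arcHalfWidth ‖p‖) := by
    intro p hp
    rw [← MeasureTheory.measure_congr AddCircle.closedBall_ae_eq_ball,
      AddCircle.volume_closedBall, min_eq_right]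
    linarith [arcHalfWidth_le (h1 p hp), Real.pi_pos]
  have h0 : ∀ p ∈ S, 0 ≤ 2 * arcHalfWidth ‖p‖ := fun p hp =>
    mul_nonneg (by norm_num) (arcHalfWidth_nonneg (h1 p hp) (h3 p hp))
  rw [Finset.sum_congr rfl hv, AddCircle.measure_univ, ← ENNReal.ofReal_sum_of_nonneg h0,
    ENNReal.ofReal_le_ofReal_iff Real.two_pi_pos.le, ← Finset.mul_sum] at hm
  linarith

lemma three_pow_card_le_prod_norm_sq (S : Finset ℂ) (h1 : ∀ p ∈ S, 1 ≤ ‖p‖)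
    (hS : ∀ p ∈ S, ∀ q ∈ S, p ≠ q → 1 ≤ ‖p - q‖) :
    (3 : ℝ) ^ #S ≤ 3 ^ 6 * ∏ p ∈ S, ‖p‖ ^ 2 := by
  have hl := log_three_pos
  have hpi := Real.pi_pos
  have hpos : ∀ p ∈ S, 0 < ‖p‖ ^ 2 := fun p hp => by have := h1 p hp; positivity
  have hnear := sum_arcHalfWidth_le (S.filter fun p => ‖p‖ ^ 2 ≤ 3)
    (fun p hp => h1 p (Finset.mem_filter.1 hp).1) (fun p hp => (Finset.mem_filter.1 hp).2)
    (fun p hp q hq => hS p (Finset.mem_filter.1 hp).1 q (Finset.mem_filter.1 hq).1)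
  have hall : ∑ p ∈ S, arcHalfWidth ‖p‖ ≤ Real.pi := by
    rw [← Finset.sum_filter_add_sum_filter_not S (fun p => ‖p‖ ^ 2 ≤ 3)]
    have hfar : ∑ p ∈ S.filter (fun p => ¬ ‖p‖ ^ 2 ≤ 3), arcHalfWidth ‖p‖ ≤ 0 := by
      refine Finset.sum_nonpos fun p hp => ?_
      rw [arcHalfWidth_eq_mul]
      refine mul_nonpos_of_nonneg_of_nonpos (by positivity) (sub_nonpos.2 ?_)
      exact Real.log_le_log (by norm_num) (not_le.1 (Finset.mem_filter.1 hp).2).le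
    linarith
  simp only [arcHalfWidth_eq_mul] at hall
  rw [← Finset.mul_sum, Finset.sum_sub_distrib, Finset.sum_const, nsmul_eq_mul] at hall
  rw [← Real.log_prod (fun p hp => (hpos p hp).ne')] at hall
  have h6 : #S * Real.log 3 - Real.log (∏ p ∈ S, ‖p‖ ^ 2) ≤ 6 * Real.log 3 := by
    have : Real.pi = Real.pi / (6 * Real.log 3) * (6 * Real.log 3) := by field_simp
    nth_rewrite 2 [this] at hall
    exact le_of_mul_le_mul_left hall (by positivity)
  have hP := Finset.prod_pos hpos
  rw [← Real.log_le_log_iff (by positivity) (by positivity), Real.log_mul (by positivity) hP.ne',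
    Real.log_pow, Real.log_pow]
  push_cast
  linarith

lemma three_pow_mul_four_pow_le_prod_norm_sq (S : Finset ℂ) (h1 : ∀ p ∈ S, 1 ≤ ‖p‖)
    (hS : ∀ p ∈ S, ∀ q ∈ S, p ≠ q → 1 ≤ ‖p - q‖) (hcard : 24 ≤ #S) :
    (3 : ℝ) ^ 24 * 4 ^ (#S - 24) ≤ 3 ^ 6 * ∏ p ∈ S, ‖p‖ ^ 2 := by
  set T := S.filter fun p => ‖p‖ ≤ 2 with hT
  have hTS : ∀ p ∈ T, p ∈ S := fun p hp => (Finset.mem_filter.1 hp).1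
  have h0 : (0 : ℂ) ∉ T := fun h => by have := h1 0 (hTS 0 h); norm_num at this
  have hTcard : #T ≤ 24 := by
    have := Besicovitch.card_le_of_separated (insert 0 T) (by
      simp only [Finset.mem_insert, forall_eq_or_imp, norm_zero]
      exact ⟨by norm_num, fun p hp => (Finset.mem_filter.1 hp).2⟩) (by
      simp only [Finset.mem_insert]
      rintro c (rfl | hc) d (rfl | hd) hcd
      · exact absurd rfl hcd
      · simpa using h1 d (hTS d hd)
      · simpa using h1 c (hTS c hc)
      · exact hS c (hTS c hc) d (hTS d hd) hcd)
    rw [Finset.card_insert_of_notMem h0, Complex.finrank_real_complex] at this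
    omega
  have hnear := three_pow_card_le_prod_norm_sq T (fun p hp => h1 p (hTS p hp))
    (fun p hp q hq => hS p (hTS p hp) q (hTS q hq))
  have hfar : (4 : ℝ) ^ #(S.filter fun p => ¬ ‖p‖ ≤ 2) ≤
      ∏ p ∈ S.filter (fun p => ¬ ‖p‖ ≤ 2), ‖p‖ ^ 2 := by
    rw [← Finset.prod_const]
    refine Finset.prod_le_prod (fun _ _ => by norm_num) fun p hp => ?_
    have := not_le.1 (Finset.mem_filter.1 hp).2
    nlinarith
  have hsum := Finset.card_filter_add_card_filter_not (s := S) (fun p : ℂ => ‖p‖ ≤ 2)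
  rw [← hT] at hsum
  rw [← Finset.prod_filter_mul_prod_filter_not S (fun p : ℂ => ‖p‖ ≤ 2), ← mul_assoc]
  obtain ⟨e, he⟩ := Nat.exists_eq_add_of_le hTcard
  have hF : #(S.filter fun p => ¬ ‖p‖ ≤ 2) = e + (#S - 24) := by omega
  calc (3 : ℝ) ^ 24 * 4 ^ (#S - 24) = 3 ^ #T * (3 ^ e * 4 ^ (#S - 24)) := by
        rw [he, pow_add, mul_assoc]
    _ ≤ 3 ^ #T * (4 ^ e * 4 ^ (#S - 24)) := by gcongr; norm_num
    _ = 3 ^ #T * 4 ^ #(S.filter fun p => ¬ ‖p‖ ≤ 2) := by rw [hF, pow_add]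
    _ ≤ _ := mul_le_mul hnear hfar (by positivity) (by positivity)

/-- Pigeonhole on a grid of `k` by `l` rectangles with sides `4/5` and `3/5`. -/
lemma le_diam_of_separated {ι : Type*} [Fintype ι] [Nonempty ι] (z : ι → ℂ) (s : ℝ)
    (hsep : ∀ i j, i ≠ j → 1 ≤ ‖z i - z j‖) (hdiam : ∀ i j, ‖z i - z j‖ ≤ s) (k l : ℕ)
    (hkl : k * l < Fintype.card ι) {t : ℝ} (hk : t ≤ 4 / 5 * k) (hl : t ≤ 3 / 5 * l) :
    t ≤ s := by
  by_contra! hst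
  obtain ⟨a, ha⟩ := Finite.exists_min fun i => (z i).re
  obtain ⟨b, hb⟩ := Finite.exists_min fun i => (z i).im
  have hx : ∀ i, (z i).re - (z a).re < 4 / 5 * k := fun i => by
    have := (Complex.re_le_norm (z i - z a)).trans (hdiam i a)
    rw [Complex.sub_re] at this
    linarith
  have hy : ∀ i, (z i).im - (z b).im < 3 / 5 * l := fun i => by
    have := (Complex.im_le_norm (z i - z b)).trans (hdiam i b)
    rw [Complex.sub_im] at this
    linarith
  obtain ⟨i, -, j, -, hij, hf⟩ := Finset.exists_ne_map_eq_of_card_lt_of_maps_to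
    (s := (Finset.univ : Finset ι)) (t := Finset.range k ×ˢ Finset.range l)
    (f := fun i => (⌊5 / 4 * ((z i).re - (z a).re)⌋₊, ⌊5 / 3 * ((z i).im - (z b).im)⌋₊))
    (by simpa using hkl) (by
      intro i _
      have h1 := hx i
      have h2 := hy i
      have h3 := ha i
      have h4 := hb i
      simp only [Finset.coe_product, Set.mem_prod, Finset.coe_range, Set.mem_Iio]
      rw [Nat.floor_lt (by linarith), Nat.floor_lt (by linarith)]
      constructor <;> linarith)
  rw [Prod.mk.injEq] at hf
  have hre : |(z i).re - (z j).re| < 4 / 5 := by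
    have h1 := Nat.floor_le (show 0 ≤ 5 / 4 * ((z i).re - (z a).re) by linarith [ha i])
    have h2 := Nat.floor_le (show 0 ≤ 5 / 4 * ((z j).re - (z a).re) by linarith [ha j])
    have h3 := Nat.lt_floor_add_one (5 / 4 * ((z i).re - (z a).re))
    have h4 := Nat.lt_floor_add_one (5 / 4 * ((z j).re - (z a).re))
    rw [hf.1] at h1 h3
    rw [abs_lt]
    constructor <;> linarith
  have him : |(z i).im - (z j).im| < 3 / 5 := by
    have h1 := Nat.floor_le (show 0 ≤ 5 / 3 * ((z i).im - (z b).im) by linarith [hb i])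
    have h2 := Nat.floor_le (show 0 ≤ 5 / 3 * ((z j).im - (z b).im) by linarith [hb j])
    have h3 := Nat.lt_floor_add_one (5 / 3 * ((z i).im - (z b).im))
    have h4 := Nat.lt_floor_add_one (5 / 3 * ((z j).im - (z b).im))
    rw [hf.2] at h1 h3
    rw [abs_lt]
    constructor <;> linarith
  have h1 : 1 ≤ ‖z i - z j‖ ^ 2 := one_le_pow₀ (hsep i j hij)
  rw [Complex.sq_norm, Complex.normSq_apply, Complex.sub_re, Complex.sub_im] at h1
  have h2 := sq_lt_sq' (by linarith [(abs_lt.1 hre).1]) (abs_lt.1 hre).2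
  have h3 := sq_lt_sq' (by linarith [(abs_lt.1 him).1]) (abs_lt.1 him).2
  nlinarith

lemma choose_le_mul_two_pow (n k : ℕ) (hn : 24 ≤ n) :
    (n.choose k : ℝ) ≤ 2704156 * 2 ^ (n - 24) := by
  induction n, hn using Nat.le_induction generalizing k with
  | base =>
    have h : Nat.choose 24 k ≤ 2704156 := (Nat.choose_le_middle k 24).trans (by norm_num [Nat.choose])
    have : ((Nat.choose 24 k : ℕ) : ℝ) ≤ (2704156 : ℕ) := Nat.cast_le.2 h
    simpa using this
  | succ n hn ih =>
    have hp : (2 : ℝ) ^ (n + 1 - 24) = 2 * 2 ^ (n - 24) := by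
      rw [Nat.sub_add_comm hn, pow_succ']
    cases k with
    | zero =>
      have : (1 : ℝ) ≤ 2 ^ (n + 1 - 24) := one_le_pow₀ (by norm_num)
      simp only [Nat.choose_zero_right, Nat.cast_one]
      linarith
    | succ k =>
      rw [Nat.choose_succ_succ, Nat.cast_add, hp]
      linarith [ih k, ih (k + 1)]

lemma choose_le_of_packing_bounds (n k : ℕ) {s P : ℝ} (hs : 1 ≤ s) (hP : 1 ≤ P)
    (hs7 : 6 ≤ n → 8 / 5 ≤ s) (hs13 : 12 ≤ n → 12 / 5 ≤ s) (hs21 : 20 ≤ n → 3 ≤ s)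
    (hP3 : (3 : ℝ) ^ n ≤ 3 ^ 6 * P ^ 2)
    (hP4 : 24 ≤ n → (3 : ℝ) ^ 24 * 4 ^ (n - 24) ≤ 3 ^ 6 * P ^ 2) :
    (n.choose k : ℝ) ≤ 2 * (n + 1) * s * P := by
  have hmid : (n.choose k : ℝ) ≤ n.choose (n / 2) := Nat.cast_le.2 (Nat.choose_le_middle k n)
  refine (sq_le_sq₀ (by positivity) (by positivity)).1 ?_
  rcases lt_or_ge n 24 with hn | hn
  · have hsq : ∀ t : ℝ, 0 ≤ t → t ≤ s →
        (n.choose (n / 2) : ℝ) ^ 2 * 3 ^ 6 ≤ (2 * (n + 1) * t) ^ 2 * 3 ^ n →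
        (n.choose k : ℝ) ^ 2 ≤ (2 * (n + 1) * s * P) ^ 2 := by
      intro t ht hts h
      have h1 : (n.choose k : ℝ) ^ 2 ≤ (n.choose (n / 2) : ℝ) ^ 2 := by gcongr
      have h2 : (2 * (n + 1) * t) ^ 2 * 3 ^ n ≤ (2 * (n + 1) * s) ^ 2 * (3 ^ 6 * P ^ 2) := by
        gcongr
      rw [mul_pow (2 * ((n : ℝ) + 1) * s) P]
      linarith
    rcases lt_or_ge n 6 with h6 | h6
    · have h1 : (n.choose (n / 2) : ℝ) ≤ 2 * (n + 1) := by
        interval_cases n <;> norm_num [Nat.choose]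
      have h2 : 2 * ((n : ℝ) + 1) ≤ 2 * (n + 1) * s * P := by
        have : 1 ≤ s * P := one_le_mul_of_one_le_of_one_le hs hP
        nlinarith [Nat.cast_nonneg (α := ℝ) n]
      gcongr
      linarith
    rcases lt_or_ge n 12 with h12 | h12
    · refine hsq _ (by norm_num) (hs7 h6) ?_
      interval_cases n <;> norm_num [Nat.choose]
    rcases lt_or_ge n 20 with h20 | h20
    · refine hsq _ (by norm_num) (hs13 h12) ?_
      interval_cases n <;> norm_num [Nat.choose]
    · refine hsq _ (by norm_num) (hs21 h20) ?_
      interval_cases n <;> norm_num [Nat.choose]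
  · have h1 := choose_le_mul_two_pow n k hn
    have h2 := hP4 hn
    have h3 := hs21 (by omega)
    have hn' : (24 : ℝ) ≤ n := by exact_mod_cast hn
    have h4 : (4 : ℝ) ^ (n - 24) = (2 ^ (n - 24)) ^ 2 := by
      rw [← pow_mul, mul_comm, pow_mul]; norm_num
    calc (n.choose k : ℝ) ^ 2 ≤ (2704156 * 2 ^ (n - 24)) ^ 2 := by gcongr
      _ = 2704156 ^ 2 * 4 ^ (n - 24) := by rw [mul_pow, h4]
      _ ≤ (2 * (24 + 1) * 3) ^ 2 * 3 ^ 18 * 4 ^ (n - 24) := by gcongr; norm_num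
      _ ≤ (2 * (24 + 1) * 3) ^ 2 * P ^ 2 := by
        have : (3 : ℝ) ^ 18 * 4 ^ (n - 24) ≤ P ^ 2 := by linarith
        rw [mul_assoc]
        gcongr
      _ ≤ (2 * (n + 1) * s) ^ 2 * P ^ 2 := by gcongr
      _ = _ := by ring

lemma choose_le_diam_mul_prod_of_separated {n : ℕ} (z : Fin n → ℂ) {s : ℝ} (hs : 1 ≤ s)
    (hsep : ∀ i j, i ≠ j → 1 ≤ ‖z i - z j‖) (hdiam : ∀ i j, ‖z i - z j‖ ≤ s) (i : Fin n)
    (k : ℕ) :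
    ((n - 1).choose k : ℝ) ≤ 2 * n * s * ∏ j ∈ univ.erase i, ‖z i - z j‖ := by
  have : NeZero n := i.neZero
  have hn : ((n - 1 : ℕ) : ℝ) + 1 = n := by
    rw [← Nat.cast_add_one, Nat.sub_add_cancel i.pos]
  have hinj : Function.Injective fun j => z i - z j := by
    intro a b hab
    by_contra h
    have := hsep a b h
    rw [sub_right_injective hab, sub_self, norm_zero] at this
    linarith
  set S := (univ.erase i).image fun j => z i - z j with hS
  have hcard : #S = n - 1 := by
    rw [hS, Finset.card_image_of_injective _ hinj, Finset.card_erase_of_mem (mem_univ i),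
      Finset.card_univ, Fintype.card_fin]
  have hprod : (∏ j ∈ univ.erase i, ‖z i - z j‖) ^ 2 = ∏ p ∈ S, ‖p‖ ^ 2 := by
    rw [← Finset.prod_pow, hS, Finset.prod_image hinj.injOn]
  have hS1 : ∀ p ∈ S, 1 ≤ ‖p‖ := by
    simp only [hS, Finset.mem_image, forall_exists_index, and_imp]
    rintro _ j hj rfl
    exact hsep i j (Finset.ne_of_mem_erase hj).symm
  have hSsep : ∀ p ∈ S, ∀ q ∈ S, p ≠ q → 1 ≤ ‖p - q‖ := by
    simp only [hS, Finset.mem_image, forall_exists_index, and_imp]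
    rintro _ a - rfl _ b - rfl hab
    rw [sub_sub_sub_cancel_left]
    exact hsep b a fun h => hab (by rw [h])
  rw [← hn]
  refine choose_le_of_packing_bounds (n - 1) k hs ?_ ?_ ?_ ?_ ?_ ?_
  · rw [← Finset.prod_const_one (s := univ.erase i)]
    exact Finset.prod_le_prod (fun _ _ => zero_le_one) fun j hj =>
      hsep i j (Finset.ne_of_mem_erase hj).symm
  · exact fun h => le_diam_of_separated z s hsep hdiam 2 3
      (by rw [Fintype.card_fin]; omega) (by norm_num) (by norm_num)
  · exact fun h => le_diam_of_separated z s hsep hdiam 3 4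
      (by rw [Fintype.card_fin]; omega) (by norm_num) (by norm_num)
  · exact fun h => le_diam_of_separated z s hsep hdiam 4 5
      (by rw [Fintype.card_fin]; omega) (by norm_num) (by norm_num)
  · rw [hprod, ← hcard]
    exact three_pow_card_le_prod_norm_sq S hS1 hSsep
  · intro h
    rw [hprod, ← hcard]
    exact three_pow_mul_four_pow_le_prod_norm_sq S hS1 hSsep (hcard ▸ h)

lemma norm_coeff_prod_X_sub_C_le_s13 {ι : Type*} (s : Finset ι) (v : ι → ℂ) {R : ℝ} (hR : 1 ≤ R)
    (hv : ∀ i ∈ s, ‖v i‖ ≤ R) (k : ℕ) :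
    ‖(∏ i ∈ s, (Polynomial.X - Polynomial.C (v i))).coeff k‖ ≤ (#s).choose k * R ^ #s := by
  classical
  induction s using Finset.induction_on generalizing k with
  | empty =>
    rw [Finset.prod_empty, Polynomial.coeff_one]
    split_ifs with h <;> simp [h]
  | insert a s ha ih =>
    have ih' := ih fun i hi => hv i (Finset.mem_insert_of_mem hi)
    have hva := hv a (Finset.mem_insert_self a s)
    have hR0 : 0 ≤ R := by linarith
    rw [Finset.prod_insert ha, Finset.card_insert_of_notMem ha, sub_mul, Polynomial.coeff_sub,
      Polynomial.coeff_C_mul]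
    have hmul : ∀ k, ‖v a * (∏ i ∈ s, (Polynomial.X - Polynomial.C (v i))).coeff k‖ ≤
        (#s).choose k * R ^ (#s + 1) := fun k => by
      rw [norm_mul, pow_succ', mul_left_comm]
      exact mul_le_mul hva (ih' k) (norm_nonneg _) hR0
    cases k with
    | zero => simpa using hmul 0
    | succ k =>
      rw [Polynomial.coeff_X_mul, Nat.choose_succ_succ, Nat.cast_add, add_mul]
      refine (norm_sub_le _ _).trans (add_le_add ((ih' k).trans ?_) (hmul (k + 1)))
      gcongr
      exact Nat.le_succ _

lemma inv_shifted_vandermonde_apply {n : ℕ} (r : Fin n → ℂ) (hr : Function.Injective r)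
    (hr0 : ∀ i, r i ≠ 0) (V0 : Matrix (Fin n) (Fin n) ℂ)
    (hV0 : ∀ i j : Fin n, V0 i j = r j ^ ((i : ℕ) + 1)) (i j : Fin n) :
    V0⁻¹ i j = (r i)⁻¹ * (Lagrange.basis univ r i).coeff j := by
  have hinv : (Matrix.of fun i j : Fin n => (r i)⁻¹ * (Lagrange.basis univ r i).coeff j) * V0
      = 1 := by
    ext a b
    have hdeg : (Lagrange.basis univ r a).natDegree < n := by
      rw [Lagrange.natDegree_basis hr.injOn (mem_univ a), Finset.card_univ, Fintype.card_fin]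
      exact Nat.sub_lt a.pos one_pos
    have heval : (Lagrange.basis univ r a).eval (r b) =
        ∑ x : Fin n, (Lagrange.basis univ r a).coeff x * r b ^ (x : ℕ) := by
      rw [Polynomial.eval_eq_sum_range' hdeg, Finset.sum_range]
    have hsum : ∑ x : Fin n, (r a)⁻¹ * (Lagrange.basis univ r a).coeff x * r b ^ ((x : ℕ) + 1)
        = (r a)⁻¹ * r b * (Lagrange.basis univ r a).eval (r b) := by
      rw [heval, Finset.mul_sum]
      exact Finset.sum_congr rfl fun x _ => by ring
    simp only [Matrix.mul_apply, Matrix.of_apply, hV0]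
    rw [hsum, Matrix.one_apply]
    split_ifs with hab
    · subst hab
      rw [Lagrange.eval_basis_self hr.injOn (mem_univ a), inv_mul_cancel₀ (hr0 a), one_mul]
    · rw [Lagrange.eval_basis_of_ne hab (mem_univ b), mul_zero]
  rw [Matrix.inv_eq_left_inv hinv, Matrix.of_apply]

lemma norm_coeff_lagrange_basis_le {n : ℕ} (r : Fin n → ℂ) {M m R : ℝ} (hM1 : 1 ≤ M)
    (hm0 : 0 < m) (hm1 : m ≤ 1) (hR1 : 1 ≤ R) (hM : ∀ i j, ‖r i - r j‖ ≤ M)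
    (hm : ∀ i j, i ≠ j → m ≤ ‖r i - r j‖) (hR : ∀ i, ‖r i‖ ≤ R) (i : Fin n) (k : ℕ) :
    ‖(Lagrange.basis univ r i).coeff k‖ ≤ 2 * n * (R * M / m) ^ n := by
  have hmC : ‖(m : ℂ)‖ = m := by rw [Complex.norm_real, Real.norm_of_nonneg hm0.le]
  have hz : ∀ a b, ‖r a / m - r b / m‖ = ‖r a - r b‖ / m := fun a b => by
    rw [← sub_div, norm_div, hmC]
  have hcard : #(univ.erase i) = n - 1 := by
    rw [Finset.card_erase_of_mem (mem_univ i), Finset.card_univ, Fintype.card_fin]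
  have hchoose := choose_le_diam_mul_prod_of_separated (fun a => r a / (m : ℂ)) (s := M / m)
    ((one_le_div hm0).2 (hm1.trans hM1))
    (fun a b hab => by rw [hz, one_le_div hm0]; exact hm a b hab)
    (fun a b => by rw [hz]; gcongr; exact hM a b) i k
  simp only [hz] at hchoose
  rw [Finset.prod_div_distrib, Finset.prod_const, hcard] at hchoose
  have hD : 0 < ∏ j ∈ univ.erase i, ‖r i - r j‖ := Finset.prod_pos fun j hj =>
    hm0.trans_le (hm i j (Finset.ne_of_mem_erase hj).symm)
  have hcoeff := norm_coeff_prod_X_sub_C_le_s13 (univ.erase i) r hR1 (fun j _ => hR j) k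
  rw [hcard] at hcoeff
  obtain ⟨N, rfl⟩ : ∃ N, n = N + 1 := ⟨n - 1, (Nat.sub_add_cancel i.pos).symm⟩
  rw [Nat.add_sub_cancel] at hchoose hcoeff
  have hbasis : Lagrange.basis univ r i = Polynomial.C (∏ j ∈ univ.erase i, (r i - r j)⁻¹) *
      ∏ j ∈ univ.erase i, (Polynomial.X - Polynomial.C (r j)) := by
    simp only [Lagrange.basis, Lagrange.basisDivisor, Finset.prod_mul_distrib, map_prod]
  rw [hbasis, Polynomial.coeff_C_mul, norm_mul, norm_prod]
  simp only [norm_inv, Finset.prod_inv_distrib]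
  set D := ∏ j ∈ univ.erase i, ‖r i - r j‖
  have hR0 : 0 < R := by linarith
  have hM0 : 0 < M := by linarith
  calc D⁻¹ * ‖(∏ j ∈ univ.erase i, (Polynomial.X - Polynomial.C (r j))).coeff k‖
      ≤ D⁻¹ * (N.choose k * R ^ N) := by gcongr
    _ ≤ D⁻¹ * (2 * (N + 1 : ℕ) * (M / m) * (D / m ^ N) * R ^ N) := by gcongr
    _ = 2 * (N + 1 : ℕ) * (R ^ N * M / m ^ (N + 1)) := by field_simp; ring
    _ ≤ 2 * (N + 1 : ℕ) * (R ^ (N + 1) * M ^ (N + 1) / m ^ (N + 1)) := by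
      have h1 : R ^ N ≤ R ^ (N + 1) := pow_le_pow_right₀ hR1 (Nat.le_succ N)
      have h2 : M ≤ M ^ (N + 1) := le_self_pow₀ hM1 (Nat.succ_ne_zero N)
      gcongr
    _ = _ := by rw [div_pow, mul_pow]

lemma pos_of_eq_min_sInf {S : Set ℝ} {m : ℝ} (hm : m = min (sInf S) 1) (hS : S.Finite)
    (hne : S.Nonempty) (hpos : ∀ d ∈ S, 0 < d) : 0 < m ∧ m ≤ 1 ∧ ∀ d ∈ S, m ≤ d := by
  subst hm
  exact ⟨lt_min (hpos _ (hne.csInf_mem hS)) one_pos, min_le_right _ _,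
    fun d hd => (min_le_left _ _).trans (csInf_le hS.bddBelow hd)⟩

lemma le_of_eq_max_sSup {S : Set ℝ} {M : ℝ} (hM : M = max (sSup S) 1) (hS : S.Finite) :
    1 ≤ M ∧ ∀ d ∈ S, d ≤ M := by
  subst hM
  exact ⟨le_max_right _ _, fun d hd => (le_csSup hS.bddAbove hd).trans (le_max_left _ _)⟩

/-- Magnitude bound of the Corollary to Theorem 3: the entries of the inverse of the
shifted Vandermonde matrix `V₀` (with `(i,j)` entry `r_j^i`, `1 ≤ i,j ≤ n`) of
pairwise distinct nonzero points are bounded by `(2n/r)(RM/m)^n`. -/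
theorem inverse_shifted_vandermonde_entry_bound (n : ℕ) (hn : 2 ≤ n)
    (r : Fin n → ℂ) (hr : Function.Injective r) (hr0 : ∀ i, r i ≠ 0)
    (M m R rmin : ℝ)
    (hM : M = max (sSup {d : ℝ | ∃ i j : Fin n, d = ‖r i - r j‖}) 1)
    (hm : m = min (sInf {d : ℝ | ∃ i j : Fin n, i ≠ j ∧ d = ‖r i - r j‖}) 1)
    (hR : R = max (sSup {d : ℝ | ∃ i : Fin n, d = ‖r i‖}) 1)
    (hrmin : rmin = min (sInf {d : ℝ | ∃ i : Fin n, d = ‖r i‖}) 1)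
    (V0 : Matrix (Fin n) (Fin n) ℂ)
    (hV0 : ∀ i j : Fin n, V0 i j = r j ^ ((i : ℕ) + 1)) :
    ∀ i j : Fin n, ‖V0⁻¹ i j‖ ≤ 2 * n / rmin * (R * M / m) ^ n := by
  have hpairs : (Set.range fun p : Fin n × Fin n => ‖r p.1 - r p.2‖).Finite := Set.finite_range _
  obtain ⟨hM1, hM'⟩ := le_of_eq_max_sSup hM
    (hpairs.subset (by rintro _ ⟨i, j, rfl⟩; exact ⟨(i, j), rfl⟩))
  obtain ⟨hm0, hm1, hm'⟩ := pos_of_eq_min_sInf hm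
    (hpairs.subset (by rintro _ ⟨i, j, -, rfl⟩; exact ⟨(i, j), rfl⟩))
    ⟨_, ⟨0, by omega⟩, ⟨1, by omega⟩, by simp, rfl⟩
    (by rintro _ ⟨i, j, hij, rfl⟩; exact norm_pos_iff.2 (sub_ne_zero.2 (hr.ne hij)))
  have hnorms : (Set.range fun i : Fin n => ‖r i‖).Finite := Set.finite_range _
  obtain ⟨hR1, hR'⟩ := le_of_eq_max_sSup hR
    (hnorms.subset (by rintro _ ⟨i, rfl⟩; exact ⟨i, rfl⟩))
  obtain ⟨hrmin0, -, hrmin'⟩ := pos_of_eq_min_sInf hrmin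
    (hnorms.subset (by rintro _ ⟨i, rfl⟩; exact ⟨i, rfl⟩)) ⟨_, ⟨0, by omega⟩, rfl⟩
    (by rintro _ ⟨i, rfl⟩; exact norm_pos_iff.2 (hr0 i))
  intro i j
  have hcoeff := norm_coeff_lagrange_basis_le r hM1 hm0 hm1 hR1
    (fun a b => hM' _ ⟨a, b, rfl⟩) (fun a b hab => hm' _ ⟨a, b, hab, rfl⟩)
    (fun a => hR' _ ⟨a, rfl⟩) i j
  have hri : ‖r i‖⁻¹ ≤ rmin⁻¹ := inv_anti₀ hrmin0 (hrmin' _ ⟨i, rfl⟩)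
  rw [inv_shifted_vandermonde_apply r hr hr0 V0 hV0, norm_mul, norm_inv]
  calc ‖r i‖⁻¹ * ‖(Lagrange.basis univ r i).coeff j‖
      ≤ rmin⁻¹ * (2 * n * (R * M / m) ^ n) := by gcongr
    _ = 2 * n / rmin * (R * M / m) ^ n := by ring
end
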